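/- arXiv:2111.13206 — 2 statements merged into one kernel-verified Lean document; each statement's English description precedes it below -/
import Mathlib

section
/- For 0 < α < 2, let C_α = π/(Γ(α) sin(πα/2)) and let μ be the spectral measure of the symmetric α-stable characteristic function, i.e. the finite symmetric measure on ℝ with ∫ e^{itx} μ(dx) = e^{−|t|^α}. Then μ([x,∞)) ~ C_α^{−1} x^{−α} as x → ∞; consequently h(y) ~ (C_α y)^{−1/α} as y ↓ 0 and δ_u ~ C_α^{1/α} u^{−2/α} as u → ∞, where h(y) = inf{x ≥ 0 : μ([x,∞)) ≤ y} and δ_u = (h(u^{−2}))^{−1}. -/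
open MeasureTheory ProbabilityTheory Filter

/-- Tonelli for nonnegative functions on `(0, ∞)²`. -/
theorem integral_Ioi_swap_of_nonneg {f : ℝ → ℝ → ℝ} {g h : ℝ → ℝ}
    (hf : Measurable (Function.uncurry f))
    (hf0 : ∀ x ∈ Set.Ioi (0 : ℝ), ∀ y ∈ Set.Ioi (0 : ℝ), 0 ≤ f x y)
    (hg : ∀ x ∈ Set.Ioi (0 : ℝ), ∫ y in Set.Ioi 0, f x y = g x)
    (hi : ∀ y ∈ Set.Ioi (0 : ℝ), IntegrableOn (fun x => f x y) (Set.Ioi 0))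
    (hh : ∀ y ∈ Set.Ioi (0 : ℝ), ∫ x in Set.Ioi 0, f x y = h y)
    (hhi : IntegrableOn h (Set.Ioi 0)) :
    IntegrableOn g (Set.Ioi 0) ∧
      ∫ x in Set.Ioi 0, g x = ∫ y in Set.Ioi 0, h y := by
  have hprod : Integrable (Function.uncurry f)
      ((volume.restrict (Set.Ioi (0 : ℝ))).prod (volume.restrict (Set.Ioi (0 : ℝ)))) := by
    rw [integrable_prod_iff' hf.aestronglyMeasurable]
    refine ⟨ae_restrict_of_forall_mem measurableSet_Ioi hi, ?_⟩
    refine hhi.congr (ae_restrict_of_forall_mem measurableSet_Ioi fun y hy => ?_)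
    rw [← hh y hy]
    refine setIntegral_congr_fun measurableSet_Ioi fun x hx => ?_
    exact (Real.norm_of_nonneg (hf0 x hx y hy)).symm
  refine ⟨hprod.integral_prod_left.congr (ae_restrict_of_forall_mem measurableSet_Ioi hg), ?_⟩
  rw [← setIntegral_congr_fun measurableSet_Ioi hg, ← setIntegral_congr_fun measurableSet_Ioi hh]
  exact integral_integral_swap hprod

theorem integral_Ioi_rpow_div_one_add_sq {α : ℝ} (hα0 : 0 < α) (hα2 : α < 2) :
    IntegrableOn (fun s : ℝ => s ^ (α - 1) / (1 + s ^ 2)) (Set.Ioi 0) ∧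
      ∫ s in Set.Ioi (0 : ℝ), s ^ (α - 1) / (1 + s ^ 2) =
        Real.pi / (2 * Real.sin (Real.pi * α / 2)) := by
  have key := integral_Ioi_swap_of_nonneg
    (f := fun s r => s ^ (α - 1) * Real.exp (-(r * (1 + s ^ 2))))
    (g := fun s => s ^ (α - 1) / (1 + s ^ 2))
    (h := fun r => 1 / 2 * Real.Gamma (α / 2) * (Real.exp (-r) * r ^ (1 - α / 2 - 1)))
    (by unfold Function.uncurry; fun_prop)
    (fun s hs r hr => by have : 0 < s := hs; positivity) ?_ ?_ ?_ ?_
  · refine ⟨key.1, key.2.trans ?_⟩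
    rw [integral_const_mul, ← Real.Gamma_eq_integral (by linarith), mul_assoc,
      Real.Gamma_mul_Gamma_one_sub]
    rw [show Real.pi * (α / 2) = Real.pi * α / 2 by ring]
    field_simp
  · intro s _
    rw [integral_const_mul]
    have := Real.integral_rpow_mul_exp_neg_mul_Ioi (a := 1) (r := 1 + s ^ 2) one_pos (by positivity)
    simp only [sub_self, Real.rpow_zero, one_mul, Real.Gamma_one, Real.rpow_one, mul_one] at this
    simp_rw [mul_comm _ (1 + s ^ 2), this]
    ring
  · intro r hr
    have := (integrableOn_rpow_mul_exp_neg_mul_rpow (s := α - 1) (p := 2) (b := r)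
      (by linarith) (by norm_num) hr).const_mul (Real.exp (-r))
    refine this.congr (ae_of_all _ fun s => ?_)
    simp only [Real.rpow_two]
    rw [show -(r * (1 + s ^ 2)) = -r + -r * s ^ 2 by ring, Real.exp_add]
    ring
  · intro r hr
    have hr' : 0 < r := hr
    have := integral_rpow_mul_exp_neg_mul_rpow (q := α - 1) (p := 2) (b := r)
      (by norm_num) (by linarith) hr
    simp only [Real.rpow_two] at this
    simp_rw [show ∀ s : ℝ, s ^ (α - 1) * Real.exp (-(r * (1 + s ^ 2))) =
      Real.exp (-r) * (s ^ (α - 1) * Real.exp (-r * s ^ 2)) from fun s => by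
        rw [show -(r * (1 + s ^ 2)) = -r + -r * s ^ 2 by ring, Real.exp_add]; ring]
    rw [integral_const_mul, this, show α - 1 + 1 = α by ring,
      show 1 - α / 2 - 1 = -α / 2 by ring]
    ring
  · exact (Real.GammaIntegral_convergent (s := 1 - α / 2) (by linarith)).const_mul _

theorem integral_Ioi_one_sub_cos_mul_exp {s : ℝ} (hs : 0 < s) :
    IntegrableOn (fun x : ℝ => (1 - Real.cos x) * Real.exp (-(s * x))) (Set.Ioi 0) ∧
      ∫ x in Set.Ioi (0 : ℝ), (1 - Real.cos x) * Real.exp (-(s * x)) = 1 / (s * (1 + s ^ 2)) := by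
  set F : ℝ → ℝ := fun x => Real.exp (-(s * x)) *
    (-1 / s - (Real.sin x - s * Real.cos x) / (1 + s ^ 2)) with hF
  have hd : ∀ x ∈ Set.Ici (0 : ℝ),
      HasDerivAt F ((1 - Real.cos x) * Real.exp (-(s * x))) x := by
    intro x _
    have h1 : HasDerivAt (fun x => Real.exp (-(s * x))) (Real.exp (-(s * x)) * -(s * 1)) x :=
      ((hasDerivAt_id x).const_mul s).neg.exp
    have h2 := ((((Real.hasDerivAt_sin x).sub ((Real.hasDerivAt_cos x).const_mul s)).div_const
      (1 + s ^ 2)).const_sub (-1 / s))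
    convert! h1.mul h2 using 1
    simp only [Pi.sub_apply]
    field_simp
    ring
  have hnn : ∀ x ∈ Set.Ioi (0 : ℝ), 0 ≤ (1 - Real.cos x) * Real.exp (-(s * x)) := fun x _ =>
    mul_nonneg (sub_nonneg.2 (Real.cos_le_one x)) (Real.exp_pos _).le
  have hlim : Tendsto F atTop (nhds 0) := by
    have h1 : Tendsto (fun x => Real.exp (-(s * x))) atTop (nhds 0) :=
      Real.tendsto_exp_neg_atTop_nhds_zero.comp (tendsto_id.const_mul_atTop hs)
    refine h1.zero_mul_isBoundedUnder_le ⟨1 / s + (1 + s) / (1 + s ^ 2), ?_⟩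
    simp only [eventually_map, Function.comp_apply, Real.norm_eq_abs]
    refine .of_forall fun x => ?_
    have h3 : |Real.sin x - s * Real.cos x| ≤ 1 + s := by
      refine (abs_sub _ _).trans (add_le_add (Real.abs_sin_le_one x) ?_)
      rw [abs_mul, abs_of_pos hs]
      exact mul_le_of_le_one_right hs.le (Real.abs_cos_le_one x)
    refine (abs_sub _ _).trans (add_le_add ?_ ?_)
    · rw [abs_div, abs_neg, abs_one, abs_of_pos hs]
    · rw [abs_div, abs_of_pos (show 0 < 1 + s ^ 2 by positivity)]
      gcongr
  refine ⟨integrableOn_Ioi_deriv_of_nonneg' hd hnn hlim, ?_⟩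
  rw [integral_Ioi_of_hasDerivAt_of_nonneg' hd hnn hlim]
  simp only [hF, mul_zero, neg_zero, Real.exp_zero, Real.sin_zero, Real.cos_zero]
  field_simp
  ring

theorem integral_Ioi_rpow_mul_one_sub_cos {α : ℝ} (hα0 : 0 < α) (hα2 : α < 2) :
    IntegrableOn (fun x : ℝ => x ^ (-1 - α) * (1 - Real.cos x)) (Set.Ioi 0) ∧
      ∫ x in Set.Ioi (0 : ℝ), x ^ (-1 - α) * (1 - Real.cos x) =
        Real.pi / (2 * Real.Gamma (α + 1) * Real.sin (Real.pi * α / 2)) := by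
  have hΓ : 0 < Real.Gamma (α + 1) := Real.Gamma_pos_of_pos (by linarith)
  obtain ⟨hi, hv⟩ := integral_Ioi_rpow_div_one_add_sq hα0 hα2
  have key := integral_Ioi_swap_of_nonneg
    (f := fun x s => s ^ α * ((1 - Real.cos x) * Real.exp (-(s * x))))
    (g := fun x => Real.Gamma (α + 1) * (x ^ (-1 - α) * (1 - Real.cos x)))
    (h := fun s => s ^ (α - 1) / (1 + s ^ 2))
    (by unfold Function.uncurry; fun_prop)
    (fun x _ s hs => mul_nonneg (Real.rpow_nonneg (le_of_lt hs) _)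
      (mul_nonneg (sub_nonneg.2 (Real.cos_le_one x)) (Real.exp_pos _).le)) ?_ ?_ ?_ hi
  · constructor
    · simpa [IntegrableOn, ← mul_assoc, hΓ.ne'] using key.1.const_mul (Real.Gamma (α + 1))⁻¹
    · have := key.2
      rw [integral_const_mul, hv] at this
      rw [eq_div_of_mul_eq hΓ.ne' ((mul_comm _ _).trans this), div_div]
      congr 1
      ring
  · intro x hx
    have hx' : 0 < x := hx
    have := Real.integral_rpow_mul_exp_neg_mul_Ioi (a := α + 1) (r := x) (by linarith) hx
    simp_rw [show ∀ s : ℝ, s ^ α * ((1 - Real.cos x) * Real.exp (-(s * x))) =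
      (1 - Real.cos x) * (s ^ (α + 1 - 1) * Real.exp (-(x * s))) from fun s => by
        rw [add_sub_cancel_right, mul_comm s x]; ring]
    rw [integral_const_mul, this, one_div, Real.inv_rpow hx'.le, ← Real.rpow_neg hx'.le]
    ring_nf
  · intro s hs
    exact (integral_Ioi_one_sub_cos_mul_exp hs).1.const_mul _
  · intro s hs
    have hs' : 0 < s := hs
    rw [integral_const_mul, (integral_Ioi_one_sub_cos_mul_exp hs).2, Real.rpow_sub_one hs'.ne']
    field_simp

open FourierTransform in
/-- A smooth even function that is compactly supported and equals `1` near the origin is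
a cosine transform; we record its complement `χ`. -/
theorem exists_cutoff_eq_integral_one_sub_cos {a b : ℝ} (ha : 0 < a) (hab : a < b) :
    ∃ χ β : ℝ → ℝ, Continuous χ ∧ (∀ y, 0 ≤ χ y) ∧ (∀ y, χ y ≤ 1) ∧ (∀ y, |y| ≤ a → χ y = 0) ∧
      (∀ y, b ≤ |y| → χ y = 1) ∧ Continuous β ∧ Integrable (fun ξ => (1 + ξ ^ 2) * |β ξ|) ∧
      ∀ y, χ y = ∫ ξ, β ξ * (1 - Real.cos (2 * Real.pi * ξ * y)) := by
  let B : ContDiffBump (0 : ℝ) := ⟨a, b, ha, hab⟩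
  have hcs : HasCompactSupport (fun y => (B y : ℂ)) :=
    B.hasCompactSupport.comp_left (g := fun r : ℝ => (r : ℂ)) Complex.ofReal_zero
  have hcd : ContDiff ℝ ((⊤ : ℕ∞) : WithTop ℕ∞) (fun y => (B y : ℂ)) :=
    Complex.ofRealCLM.contDiff.comp B.contDiff
  set f : SchwartzMap ℝ ℂ := hcs.toSchwartzMap hcd
  have hfB : ∀ y, f y = B y := fun y => rfl
  set β : ℝ → ℝ := fun ξ => ((𝓕 f) ξ).re
  have hβc : Continuous β := Complex.continuous_re.comp (𝓕 f).continuous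
  have hβi : Integrable (fun ξ => (1 + ξ ^ 2) * |β ξ|) := by
    refine (((𝓕 f).integrable_pow_mul volume 0).add
      ((𝓕 f).integrable_pow_mul volume 2)).mono' (by fun_prop) (ae_of_all _ fun ξ => ?_)
    have : |β ξ| ≤ ‖(𝓕 f) ξ‖ := Complex.abs_re_le_norm _
    simp only [Pi.add_apply, pow_zero, Real.norm_eq_abs, sq_abs, abs_mul, abs_abs,
      abs_of_pos (show 0 < 1 + ξ ^ 2 by positivity), ← add_mul]
    gcongr
  have hβ1 : Integrable β := hβi.mono' hβc.aestronglyMeasurable (ae_of_all _ fun ξ => by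
    rw [Real.norm_eq_abs]
    nlinarith [abs_nonneg (β ξ), sq_nonneg ξ])
  have hcos : ∀ y, Integrable (fun ξ => β ξ * Real.cos (2 * Real.pi * ξ * y)) := fun y =>
    hβ1.mul_bdd (c := 1) (by fun_prop) (ae_of_all _ fun ξ => Real.abs_cos_le_one _)
  have hFi : ∀ y : ℝ, Integrable
      (fun v : ℝ => Complex.exp ((2 * Real.pi * (v * y) : ℝ) * Complex.I) * (𝓕 f) v) := fun y =>
    (𝓕 f).integrable.bdd_mul (c := 1) (by fun_prop)
      (ae_of_all _ fun v => (Complex.norm_exp_ofReal_mul_I _).le)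
  have hinv : ∀ y : ℝ,
      (B y : ℂ) = ∫ v : ℝ, Complex.exp ((2 * Real.pi * (v * y) : ℝ) * Complex.I) * (𝓕 f) v := by
    intro y
    have h1 : (𝓕⁻ (𝓕 f)) y = f y := by rw [fourierInv_fourier_eq f]
    rw [SchwartzMap.fourierInv_coe, Real.fourierInv_eq', hfB] at h1
    rw [← h1]
    congr with v
    simp [mul_comm]
  have hB : ∀ y, B y = ∫ ξ, β ξ * Real.cos (2 * Real.pi * ξ * y) := by
    intro y
    have h2 : (2 * B y : ℂ) = ∫ v : ℝ, (2 * Real.cos (2 * Real.pi * v * y) : ℂ) * (𝓕 f) v := by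
      have h3 := hinv (-y)
      rw [B.neg] at h3
      rw [two_mul]
      nth_rewrite 1 [hinv y]
      rw [h3, ← integral_add (hFi y) (hFi (-y))]
      congr with v
      rw [← add_mul, Complex.ofReal_cos, Complex.two_cos]
      push_cast
      ring_nf
    have h5 : Integrable fun v : ℝ => (2 * Real.cos (2 * Real.pi * v * y) : ℂ) * (𝓕 f) v := by
      refine (𝓕 f).integrable.bdd_mul (c := 2) (by fun_prop) (ae_of_all _ fun v => ?_)
      rw [norm_mul, Complex.norm_real, Complex.norm_two]
      exact mul_le_of_le_one_right two_pos.le (Real.abs_cos_le_one _)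
    have h4 := congrArg Complex.re h2
    rw [← Complex.reCLM_apply (∫ v : ℝ, _), ← Complex.reCLM.integral_comp_comm h5] at h4
    have h6 : ∀ v : ℝ, Complex.reCLM ((2 * Real.cos (2 * Real.pi * v * y) : ℂ) * (𝓕 f) v) =
        2 * (β v * Real.cos (2 * Real.pi * v * y)) := fun v => by
      rw [← Complex.ofReal_ofNat, ← Complex.ofReal_mul, Complex.reCLM_apply,
        Complex.re_ofReal_mul]
      ring
    simp_rw [h6] at h4
    rw [integral_const_mul, ← Complex.ofReal_ofNat, ← Complex.ofReal_mul,
      Complex.ofReal_re] at h4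
    linarith
  have hB0 : B 0 = 1 := B.one_of_mem_closedBall (by simp [ha.le, B])
  refine ⟨fun y => 1 - B y, β, continuous_const.sub B.continuous, fun y => sub_nonneg.2 B.le_one,
    fun y => sub_le_self _ B.nonneg, fun y hy => ?_, fun y hy => ?_, hβc, hβi, fun y => ?_⟩
  · exact sub_eq_zero.2 (B.one_of_mem_closedBall (by simpa [B] using hy)).symm
  · exact sub_eq_self.2 (B.zero_of_le_dist (by simpa [B] using hy))
  · simp only [mul_sub, mul_one]
    rw [integral_sub hβ1 (hcos y), ← hB y, ← hB0, hB 0]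
    simp

theorem integral_mul_cutoff {m : Measure ℝ} [SFinite m] {w ψ χ β : ℝ → ℝ} {x : ℝ}
    (hw : Measurable w) (hw0 : ∀ᵐ y ∂m, 0 ≤ w y)
    (hi : ∀ t, Integrable (fun y => w y * (1 - Real.cos (t * y))) m)
    (hψ : ∀ t, ∫ y, w y * (1 - Real.cos (t * y)) ∂m = ψ t)
    (hψle : ∀ t, ψ t ≤ 1 + t ^ 2)
    (hβc : Continuous β) (hβi : Integrable (fun ξ => (1 + ξ ^ 2) * |β ξ|))
    (hχ : ∀ y, χ y = ∫ ξ, β ξ * (1 - Real.cos (2 * Real.pi * ξ * y))) :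
    Integrable (fun y => w y * χ (y / x)) m ∧
      ∫ y, w y * χ (y / x) ∂m = ∫ ξ, β ξ * ψ (2 * Real.pi * ξ / x) := by
  set F : ℝ → ℝ → ℝ := fun ξ y => β ξ * (w y * (1 - Real.cos (2 * Real.pi * ξ / x * y))) with hF
  have hFm : Measurable (Function.uncurry F) := by
    have := hβc.measurable
    unfold Function.uncurry
    fun_prop
  have hnorm : ∀ ξ, ∫ y, ‖F ξ y‖ ∂m = |β ξ| * ψ (2 * Real.pi * ξ / x) := by
    intro ξ
    rw [← hψ, ← integral_const_mul]
    refine integral_congr_ae (hw0.mono fun y hy => ?_)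
    simp only [hF, norm_mul, Real.norm_eq_abs]
    rw [abs_of_nonneg hy, abs_of_nonneg (sub_nonneg.2 (Real.cos_le_one _))]
  have hprod : Integrable (Function.uncurry F) (volume.prod m) := by
    rw [integrable_prod_iff hFm.aestronglyMeasurable]
    refine ⟨ae_of_all _ fun ξ => (hi (2 * Real.pi * ξ / x)).const_mul (β ξ), ?_⟩
    refine (hβi.const_mul (1 + (2 * Real.pi / x) ^ 2)).mono'
      hFm.aestronglyMeasurable.norm.integral_prod_right' (ae_of_all _ fun ξ => ?_)
    rw [Real.norm_of_nonneg (integral_nonneg fun _ => norm_nonneg _)]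
    refine (hnorm ξ).trans_le ?_
    have h1 : ψ (2 * Real.pi * ξ / x) ≤ (1 + (2 * Real.pi / x) ^ 2) * (1 + ξ ^ 2) := by
      refine (hψle _).trans ?_
      rw [show 2 * Real.pi * ξ / x = 2 * Real.pi / x * ξ by ring, mul_pow]
      nlinarith [sq_nonneg ξ, sq_nonneg (2 * Real.pi / x)]
    calc |β ξ| * ψ (2 * Real.pi * ξ / x)
        ≤ |β ξ| * ((1 + (2 * Real.pi / x) ^ 2) * (1 + ξ ^ 2)) := by gcongr
      _ = _ := by ring
  have hinner : ∀ y, ∫ ξ, F ξ y = w y * χ (y / x) := by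
    intro y
    rw [hχ, ← integral_const_mul]
    congr with ξ
    simp only [hF]
    rw [show 2 * Real.pi * ξ / x * y = 2 * Real.pi * ξ * (y / x) by ring]
    ring
  refine ⟨hprod.integral_prod_right.congr (ae_of_all _ hinner), ?_⟩
  simp_rw [← hinner]
  rw [← integral_integral_swap hprod]
  simp only [hF, integral_const_mul, hψ]

/-- The Lévy measure of the symmetric stable law, folded onto `(0, ∞)`. -/
theorem integral_Ioi_rpow_mul_one_sub_cos_mul {α : ℝ} (hα0 : 0 < α) (hα2 : α < 2) (t : ℝ) :
    IntegrableOn (fun y : ℝ => 2 * Real.Gamma (α + 1) * Real.sin (Real.pi * α / 2) / Real.pi *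
        y ^ (-1 - α) * (1 - Real.cos (t * y))) (Set.Ioi 0) ∧
      ∫ y in Set.Ioi (0 : ℝ), 2 * Real.Gamma (α + 1) * Real.sin (Real.pi * α / 2) / Real.pi *
        y ^ (-1 - α) * (1 - Real.cos (t * y)) = |t| ^ α := by
  obtain ⟨hi, hv⟩ := integral_Ioi_rpow_mul_one_sub_cos hα0 hα2
  have hΓ : 0 < Real.Gamma (α + 1) := Real.Gamma_pos_of_pos (by linarith)
  have hsin : 0 < Real.sin (Real.pi * α / 2) :=
    Real.sin_pos_of_pos_of_lt_pi (by positivity) (by nlinarith [Real.pi_pos])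
  set k := 2 * Real.Gamma (α + 1) * Real.sin (Real.pi * α / 2) / Real.pi with hk
  rcases eq_or_ne t 0 with rfl | ht
  · simp [IntegrableOn, Real.zero_rpow hα0.ne']
  have ht' : 0 < |t| := abs_pos.2 ht
  have heq : Set.EqOn (fun y : ℝ => k * |t| ^ (1 + α) *
      ((fun x : ℝ => x ^ (-1 - α) * (1 - Real.cos x)) (|t| * y)))
      (fun y => k * y ^ (-1 - α) * (1 - Real.cos (t * y))) (Set.Ioi 0) := by
    intro y hy
    have hy' : 0 < y := hy
    have h1 : Real.cos (|t| * y) = Real.cos (t * y) := by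
      rw [← Real.cos_abs (t * y), abs_mul, abs_of_pos hy']
    have h2 : |t| ^ (1 + α) * |t| ^ (-1 - α) = 1 := by
      rw [← Real.rpow_add ht', show 1 + α + (-1 - α) = 0 by ring, Real.rpow_zero]
    simp only [h1, Real.mul_rpow ht'.le hy'.le]
    calc _ = k * (|t| ^ (1 + α) * |t| ^ (-1 - α)) * y ^ (-1 - α) * (1 - Real.cos (t * y)) := by ring
      _ = _ := by rw [h2, mul_one]
  constructor
  · refine IntegrableOn.congr_fun ?_ heq measurableSet_Ioi
    refine Integrable.const_mul ?_ _
    exact (integrableOn_Ioi_comp_mul_left_iff _ 0 ht').2 (by simpa using hi)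
  · rw [← setIntegral_congr_fun measurableSet_Ioi heq, integral_const_mul,
      integral_comp_mul_left_Ioi (fun x : ℝ => x ^ (-1 - α) * (1 - Real.cos x)) 0 ht', mul_zero, hv,
      Real.rpow_add ht', Real.rpow_one, hk,
      smul_eq_mul]
    have hsin' := hsin.ne'
    generalize Real.sin (Real.pi * α / 2) = S at hsin' ⊢
    field_simp

theorem integral_Ioi_const_mul_rpow {α k c : ℝ} (hα0 : 0 < α) (hc : 0 < c) :
    ∫ y in Set.Ioi c, k * y ^ (-1 - α) = k / α * c ^ (-α) := by
  rw [integral_const_mul, integral_Ioi_rpow_of_lt (by linarith) hc,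
    show -1 - α + 1 = -α by ring]
  field_simp

theorem integral_rpow_mul_cutoff_mem_Icc {α k a b : ℝ} {χ : ℝ → ℝ} (hα0 : 0 < α) (hk : 0 ≤ k)
    (ha : 0 < a) (hab : a < b) (hχ0 : ∀ y, 0 ≤ χ y) (hχ1 : ∀ y, χ y ≤ 1)
    (hχa : ∀ y, |y| ≤ a → χ y = 0) (hχb : ∀ y, b ≤ |y| → χ y = 1)
    (hi : IntegrableOn (fun y => k * y ^ (-1 - α) * χ y) (Set.Ioi 0)) :
    ∫ y in Set.Ioi 0, k * y ^ (-1 - α) * χ y ∈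
      Set.Icc (k / α * b ^ (-α)) (k / α * a ^ (-α)) := by
  have hb : 0 < b := ha.trans hab
  have hw0 : ∀ y ∈ Set.Ioi (0 : ℝ), 0 ≤ k * y ^ (-1 - α) := fun y hy =>
    mul_nonneg hk (Real.rpow_nonneg (le_of_lt hy) _)
  constructor
  · rw [← integral_Ioi_const_mul_rpow hα0 hb]
    calc ∫ y in Set.Ioi b, k * y ^ (-1 - α) = ∫ y in Set.Ioi b, k * y ^ (-1 - α) * χ y :=
          setIntegral_congr_fun measurableSet_Ioi fun y hy => by
            simp only [hχb y ((le_of_lt hy).trans (le_abs_self y)), mul_one]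
      _ ≤ _ := setIntegral_mono_set hi
          (ae_restrict_of_forall_mem measurableSet_Ioi fun y hy => mul_nonneg (hw0 y hy) (hχ0 y))
          (Set.Ioi_subset_Ioi hb.le).eventuallyLE
  · have h1 : ∫ y in Set.Ioi 0, k * y ^ (-1 - α) * χ y =
        ∫ y in Set.Ioi a, k * y ^ (-1 - α) * χ y := by
      refine setIntegral_eq_of_subset_of_forall_sdiff_eq_zero measurableSet_Ioi
        (Set.Ioi_subset_Ioi ha.le) fun y hy => ?_
      have h0 : 0 < y := hy.1
      rw [hχa y (by rw [abs_of_pos h0]; exact not_lt.1 hy.2), mul_zero]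
    rw [← integral_Ioi_const_mul_rpow hα0 ha, h1]
    exact setIntegral_mono_on (hi.mono_set (Set.Ioi_subset_Ioi ha.le))
      ((integrableOn_Ioi_rpow_of_lt (by linarith) ha).const_mul k) measurableSet_Ioi
      fun y hy => mul_le_of_le_one_right (hw0 y (ha.trans hy)) (hχ1 y)

theorem tendsto_mul_one_sub_exp_neg_div {c : ℝ} (hc : 0 ≤ c) :
    Tendsto (fun s : ℝ => s * (1 - Real.exp (-(c / s)))) atTop (nhds c) := by
  have h1 : Tendsto (fun s : ℝ => c / (1 + c / s)) atTop (nhds c) := by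
    have : Tendsto (fun s : ℝ => c / (1 + c / s)) atTop (nhds (c / (1 + 0))) :=
      tendsto_const_nhds.div (tendsto_const_nhds.add (tendsto_const_nhds.div_atTop tendsto_id))
        (by norm_num)
    simpa using this
  refine tendsto_of_tendsto_of_tendsto_of_le_of_le' h1 tendsto_const_nhds ?_ ?_
  · filter_upwards [eventually_gt_atTop 0] with s hs
    have hv : 0 ≤ c / s := by positivity
    have h2 : Real.exp (-(c / s)) ≤ 1 / (1 + c / s) := by
      rw [Real.exp_neg, ← one_div]
      gcongr
      linarith [Real.add_one_le_exp (c / s)]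
    calc c / (1 + c / s) = s * (1 - 1 / (1 + c / s)) := by
          field_simp
          ring
      _ ≤ _ := by gcongr
  · filter_upwards [eventually_gt_atTop 0] with s hs
    have h2 := Real.add_one_le_exp (-(c / s))
    calc s * (1 - Real.exp (-(c / s))) ≤ s * (c / s) := by gcongr; linarith
      _ = c := by field_simp

theorem abs_rpow_le_one_add_sq {α : ℝ} (hα0 : 0 ≤ α) (hα2 : α ≤ 2) (t : ℝ) :
    |t| ^ α ≤ 1 + t ^ 2 := by
  rcases le_total |t| 1 with h | h
  · exact (Real.rpow_le_one (abs_nonneg t) h hα0).trans (by nlinarith [sq_nonneg t])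
  · calc |t| ^ α ≤ |t| ^ (2 : ℝ) := Real.rpow_le_rpow_of_exponent_le h hα2
      _ = t ^ 2 := by rw [Real.rpow_two, sq_abs]
      _ ≤ _ := by linarith

theorem tendsto_rpow_mul_integral_cutoff {α : ℝ} (hα0 : 0 < α) (hα2 : α < 2)
    {μ : Measure ℝ} [IsFiniteMeasure μ]
    (hμ : ∀ t, ∫ y, (1 - Real.cos (t * y)) ∂μ = 1 - Real.exp (-|t| ^ α))
    {χ β : ℝ → ℝ}
    (hβc : Continuous β) (hβi : Integrable (fun ξ => (1 + ξ ^ 2) * |β ξ|))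
    (hχ : ∀ y, χ y = ∫ ξ, β ξ * (1 - Real.cos (2 * Real.pi * ξ * y))) :
    Tendsto (fun x : ℝ => x ^ α * ∫ y, χ (y / x) ∂μ) atTop
      (nhds (∫ ξ, β ξ * |2 * Real.pi * ξ| ^ α)) := by
  have hle : ∀ t : ℝ, 1 - Real.exp (-|t| ^ α) ≤ |t| ^ α := fun t => by
    linarith [Real.add_one_le_exp (-|t| ^ α)]
  have hx : ∀ x, ∫ y, χ (y / x) ∂μ =
      ∫ ξ, β ξ * (1 - Real.exp (-|2 * Real.pi * ξ / x| ^ α)) := fun x => by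
    have := (integral_mul_cutoff (m := μ) (w := fun _ => 1)
      (ψ := fun t => 1 - Real.exp (-|t| ^ α)) (x := x) measurable_const
      (ae_of_all _ fun _ => zero_le_one)
      (fun t => by
        refine Integrable.of_bound (C := 2) (by fun_prop) (ae_of_all _ fun y => ?_)
        rw [one_mul, Real.norm_eq_abs, abs_of_nonneg (sub_nonneg.2 (Real.cos_le_one _))]
        linarith [Real.neg_one_le_cos (t * y)])
      (fun t => by simpa using hμ t)
      (fun t => (hle t).trans (abs_rpow_le_one_add_sq hα0.le hα2.le t)) hβc hβi hχ).2
    simpa using this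
  simp_rw [hx, ← integral_const_mul]
  refine tendsto_integral_filter_of_dominated_convergence
    (fun ξ => (1 + (2 * Real.pi) ^ 2) * ((1 + ξ ^ 2) * |β ξ|)) ?_ ?_ (hβi.const_mul _) ?_
  · refine .of_forall fun x => ?_
    have := hβc.measurable
    exact Measurable.aestronglyMeasurable (by fun_prop)
  · filter_upwards [eventually_gt_atTop 0] with x hx0
    refine ae_of_all _ fun ξ => ?_
    have h1 := hle (2 * Real.pi * ξ / x)
    have h0 : 0 ≤ 1 - Real.exp (-|2 * Real.pi * ξ / x| ^ α) :=
      sub_nonneg.2 (Real.exp_le_one_iff.2 (neg_nonpos.2 (by positivity)))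
    have hxα : 0 < x ^ α := Real.rpow_pos_of_pos hx0 α
    have h2 : x ^ α * |2 * Real.pi * ξ / x| ^ α = |2 * Real.pi * ξ| ^ α := by
      rw [abs_div, abs_of_pos hx0, Real.div_rpow (abs_nonneg _) hx0.le]
      field_simp
    have h3 := abs_rpow_le_one_add_sq hα0.le hα2.le (2 * Real.pi * ξ)
    rw [Real.norm_eq_abs, abs_mul, abs_mul, abs_of_pos hxα, abs_of_nonneg h0]
    calc x ^ α * (|β ξ| * (1 - Real.exp (-|2 * Real.pi * ξ / x| ^ α)))
        ≤ x ^ α * (|β ξ| * |2 * Real.pi * ξ / x| ^ α) := by gcongr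
      _ = |β ξ| * |2 * Real.pi * ξ| ^ α := by rw [← h2]; ring
      _ ≤ |β ξ| * (1 + (2 * Real.pi * ξ) ^ 2) := by gcongr
      _ ≤ |β ξ| * ((1 + (2 * Real.pi) ^ 2) * (1 + ξ ^ 2)) := by
          gcongr
          nlinarith [sq_nonneg ξ, sq_nonneg (2 * Real.pi)]
      _ = _ := by ring
  · refine ae_of_all _ fun ξ => ?_
    have h1 := ((tendsto_mul_one_sub_exp_neg_div
      (c := |2 * Real.pi * ξ| ^ α) (by positivity)).comp (tendsto_rpow_atTop hα0)).const_mul (β ξ)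
    refine h1.congr' ?_
    filter_upwards [eventually_gt_atTop 0] with x hx0
    rw [abs_div, abs_of_pos hx0, Real.div_rpow (abs_nonneg _) hx0.le, Function.comp_apply]
    ring

theorem tendsto_rpow_mul_integral_cutoff_mem_Icc {α : ℝ} (hα0 : 0 < α) (hα2 : α < 2)
    {μ : Measure ℝ} [IsFiniteMeasure μ]
    (hμ : ∀ t, ∫ y, (1 - Real.cos (t * y)) ∂μ = 1 - Real.exp (-|t| ^ α))
    {a b : ℝ} (ha : 0 < a) (hab : a < b) :
    ∃ χ : ℝ → ℝ, Continuous χ ∧ (∀ y, 0 ≤ χ y) ∧ (∀ y, χ y ≤ 1) ∧ (∀ y, |y| ≤ a → χ y = 0) ∧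
      (∀ y, b ≤ |y| → χ y = 1) ∧
      ∃ L ∈ Set.Icc (2 * (Real.Gamma α * Real.sin (Real.pi * α / 2) / Real.pi) * b ^ (-α))
          (2 * (Real.Gamma α * Real.sin (Real.pi * α / 2) / Real.pi) * a ^ (-α)),
        Tendsto (fun x : ℝ => x ^ α * ∫ y, χ (y / x) ∂μ) atTop (nhds L) := by
  obtain ⟨χ, β, hχc, hχ0, hχ1, hχa, hχb, hβc, hβi, hχ⟩ :=
    exists_cutoff_eq_integral_one_sub_cos ha hab
  refine ⟨χ, hχc, hχ0, hχ1, hχa, hχb, _, ?_, tendsto_rpow_mul_integral_cutoff hα0 hα2 hμ hβc hβi hχ⟩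
  set k := 2 * Real.Gamma (α + 1) * Real.sin (Real.pi * α / 2) / Real.pi with hk
  have hk0 : 0 ≤ k := by
    have hΓ : 0 < Real.Gamma (α + 1) := Real.Gamma_pos_of_pos (by linarith)
    have hsin : 0 < Real.sin (Real.pi * α / 2) :=
      Real.sin_pos_of_pos_of_lt_pi (by positivity) (by nlinarith [Real.pi_pos])
    positivity
  have hν := integral_mul_cutoff (m := volume.restrict (Set.Ioi 0))
    (w := fun y => k * y ^ (-1 - α)) (ψ := fun t => |t| ^ α) (x := 1) (by fun_prop)
    (ae_restrict_of_forall_mem measurableSet_Ioi fun y hy =>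
      mul_nonneg hk0 (Real.rpow_nonneg (le_of_lt hy) _))
    (fun t => (integral_Ioi_rpow_mul_one_sub_cos_mul hα0 hα2 t).1)
    (fun t => (integral_Ioi_rpow_mul_one_sub_cos_mul hα0 hα2 t).2)
    (abs_rpow_le_one_add_sq hα0.le hα2.le) hβc hβi hχ
  simp only [div_one] at hν
  rw [← hν.2]
  have := integral_rpow_mul_cutoff_mem_Icc hα0 hk0 ha hab hχ0 hχ1 hχa hχb hν.1
  rwa [show k / α = 2 * (Real.Gamma α * Real.sin (Real.pi * α / 2) / Real.pi) by
    rw [hk, Real.Gamma_add_one hα0.ne']; field_simp] at this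

theorem tendsto_rpow_mul_measureReal_le_abs {α : ℝ} (hα0 : 0 < α) (hα2 : α < 2)
    {μ : Measure ℝ} [IsFiniteMeasure μ]
    (hμ : ∀ t, ∫ y, (1 - Real.cos (t * y)) ∂μ = 1 - Real.exp (-|t| ^ α)) :
    Tendsto (fun x : ℝ => x ^ α * μ.real {y | x ≤ |y|}) atTop
      (nhds (2 * (Real.Gamma α * Real.sin (Real.pi * α / 2) / Real.pi))) := by
  set K := 2 * (Real.Gamma α * Real.sin (Real.pi * α / 2) / Real.pi)
  have hcont : Tendsto (fun b : ℝ => K * b ^ (-α)) (nhds 1) (nhds K) := by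
    have : ContinuousAt (fun b : ℝ => K * b ^ (-α)) 1 :=
      continuousAt_const.mul (Real.continuousAt_rpow_const 1 (-α) (Or.inl one_ne_zero))
    simpa [ContinuousAt] using this
  have hmeas : ∀ x : ℝ, MeasurableSet {y : ℝ | x ≤ |y|} := fun x =>
    measurableSet_le measurable_const (by fun_prop)
  have hint : ∀ (χ : ℝ → ℝ) (x : ℝ), Continuous χ → (∀ y, 0 ≤ χ y) → (∀ y, χ y ≤ 1) →
      Integrable (fun y => χ (y / x)) μ := fun χ x hc h0 h1 =>
    Integrable.of_bound (C := 1) (by fun_prop) (ae_of_all _ fun y => by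
      rw [Real.norm_of_nonneg (h0 _)]; exact h1 _)
  have hind : ∀ x : ℝ, Integrable ({y : ℝ | x ≤ |y|}.indicator (1 : ℝ → ℝ)) μ := fun x =>
    (integrable_const (1 : ℝ)).indicator (hmeas x)
  refine tendsto_order.2 ⟨fun K' hK' => ?_, fun K' hK' => ?_⟩
  · obtain ⟨b, hbK, hb⟩ := (((hcont.mono_left nhdsWithin_le_nhds).eventually
      (lt_mem_nhds hK')).and (self_mem_nhdsWithin (s := Set.Ioi (1 : ℝ)))).exists
    obtain ⟨χ, hχc, hχ0, hχ1, hχa, -, L, hL, hlim⟩ :=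
      tendsto_rpow_mul_integral_cutoff_mem_Icc hα0 hα2 hμ one_pos hb
    filter_upwards [hlim.eventually (lt_mem_nhds (hbK.trans_le hL.1)), eventually_gt_atTop 0]
      with x hx hx0
    refine hx.trans_le ?_
    gcongr
    rw [← integral_indicator_one (hmeas x)]
    refine integral_mono (hint χ x hχc hχ0 hχ1) (hind x) fun y => ?_
    by_cases hy : x ≤ |y|
    · simpa [Set.indicator, hy] using hχ1 _
    · have : |y / x| ≤ 1 := by
        rw [abs_div, abs_of_pos hx0, div_le_one hx0]
        exact (not_le.1 hy).le
      simp [hχa _ this, hy]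
  · obtain ⟨a, ⟨haK, ha0⟩, ha⟩ := ((((hcont.mono_left nhdsWithin_le_nhds).eventually
      (gt_mem_nhds hK')).and (nhdsWithin_le_nhds (lt_mem_nhds one_pos))).and
        (self_mem_nhdsWithin (s := Set.Iio (1 : ℝ)))).exists
    obtain ⟨χ, hχc, hχ0, hχ1, -, hχb, L, hL, hlim⟩ :=
      tendsto_rpow_mul_integral_cutoff_mem_Icc hα0 hα2 hμ ha0 ha
    filter_upwards [hlim.eventually (gt_mem_nhds (hL.2.trans_lt haK)), eventually_gt_atTop 0]
      with x hx hx0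
    refine lt_of_le_of_lt ?_ hx
    gcongr
    rw [← integral_indicator_one (hmeas x)]
    refine integral_mono (hind x) (hint χ x hχc hχ0 hχ1) fun y => ?_
    by_cases hy : x ≤ |y|
    · have : 1 ≤ |y / x| := by
        rwa [abs_div, abs_of_pos hx0, one_le_div hx0]
      simp [hχb _ this, hy]
    · simpa [Set.indicator, hy] using hχ0 _

theorem measureReal_Ici_of_map_neg_eq {μ : Measure ℝ} [IsFiniteMeasure μ]
    (hμ : μ.map (fun x => -x) = μ) {x : ℝ} (hx : 0 < x) :
    μ.real (Set.Ici x) = μ.real {y | x ≤ |y|} / 2 := by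
  have h1 : {y : ℝ | x ≤ |y|} = Set.Ici x ∪ Set.Iic (-x) := by
    ext y
    simp [le_abs, le_neg]
  have h2 : μ.real (Set.Ici x) = μ.real (Set.Iic (-x)) := by
    rw [Measure.real, ← hμ, Measure.map_apply measurable_neg measurableSet_Ici, Measure.real, hμ]
    congr 2
    ext y
    simp
  rw [h1, measureReal_union (Set.Ici_disjoint_Iic.2 (by linarith)) measurableSet_Iic, ← h2]
  ring

/-- Inversion of regularly varying tails. -/
theorem tendsto_sInf_div_rpow {α c : ℝ} (hα0 : 0 < α) (hc : 0 < c) {G : ℝ → ℝ}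
    (hG : Antitone G) (hlim : Tendsto (fun x : ℝ => x ^ α * G x) atTop (nhds c)) :
    Tendsto (fun y : ℝ => sInf {x : ℝ | 0 ≤ x ∧ G x ≤ y} / (c⁻¹ * y) ^ (-α⁻¹))
      (nhdsWithin 0 (Set.Ioi 0)) (nhds 1) := by
  set X : ℝ → ℝ := fun y => (c⁻¹ * y) ^ (-α⁻¹) with hX
  have hypos : ∀ᶠ y : ℝ in nhdsWithin 0 (Set.Ioi 0), 0 < y := self_mem_nhdsWithin
  have hXtop : Tendsto X (nhdsWithin 0 (Set.Ioi 0)) atTop := by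
    refine (tendsto_rpow_neg_nhdsGT_zero (neg_neg_iff_pos.2 (inv_pos.2 hα0))).comp ?_
    refine tendsto_nhdsWithin_iff.2 ⟨?_, hypos.mono fun y hy => ?_⟩
    · refine (Continuous.tendsto' (by fun_prop) _ _ (by simp)).mono_left nhdsWithin_le_nhds
    · exact mul_pos (inv_pos.2 hc) hy
  have hratio : ∀ r : ℝ, 0 < r → Tendsto (fun y => G (r * X y) / y)
      (nhdsWithin 0 (Set.Ioi 0)) (nhds ((r ^ α)⁻¹)) := by
    intro r hr
    have h1 := (hlim.comp (hXtop.const_mul_atTop hr)).const_mul ((r ^ α)⁻¹ * c⁻¹)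
    rw [mul_assoc, inv_mul_cancel₀ hc.ne', mul_one] at h1
    refine h1.congr' (hypos.mono fun y hy => ?_)
    have hcy : 0 < c⁻¹ * y := mul_pos (inv_pos.2 hc) hy
    have h2 : (X y) ^ α = (c⁻¹ * y)⁻¹ := by
      rw [hX, ← Real.rpow_mul hcy.le, neg_mul, inv_mul_cancel₀ hα0.ne', Real.rpow_neg_one]
    have hr' : 0 < r ^ α := Real.rpow_pos_of_pos hr α
    rw [Function.comp_apply, Real.mul_rpow hr.le (Real.rpow_nonneg hcy.le _), h2]
    field_simp
  have hupper : ∀ r : ℝ, 1 < r →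
      ∀ᶠ y in nhdsWithin 0 (Set.Ioi 0), 0 ≤ r * X y ∧ G (r * X y) ≤ y := by
    intro r hr
    filter_upwards [(hratio r (by linarith)).eventually
      (gt_mem_nhds (inv_lt_one_of_one_lt₀ (Real.one_lt_rpow hr hα0))), hypos,
      hXtop.eventually_gt_atTop 0] with y hy hy0 hXy
    exact ⟨by positivity, ((div_lt_one hy0).1 hy).le⟩
  have hbdd : ∀ y, BddBelow {x : ℝ | 0 ≤ x ∧ G x ≤ y} := fun y => ⟨0, fun x hx => hx.1⟩
  refine tendsto_order.2 ⟨fun l hl => ?_, fun l hl => ?_⟩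
  · obtain ⟨r, hr, hr1⟩ := exists_between (max_lt hl one_pos)
    have hr0 : 0 < r := (le_max_right _ _).trans_lt hr
    filter_upwards [(hratio r hr0).eventually
      (lt_mem_nhds ((one_lt_inv₀ (Real.rpow_pos_of_pos hr0 α)).2
        (Real.rpow_lt_one hr0.le hr1 hα0))), hypos, hupper 2 one_lt_two,
      hXtop.eventually_gt_atTop 0] with y hy hy0 hy2 hXy
    refine ((le_max_left _ _).trans_lt hr).trans_le ((le_div_iff₀ hXy).2 ?_)
    refine le_csInf ⟨_, hy2⟩ fun x hx => ?_
    by_contra! hlt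
    exact ((one_lt_div hy0).1 hy).not_ge ((hG hlt.le).trans hx.2)
  · obtain ⟨r, hr1, hr⟩ := exists_between hl
    filter_upwards [hupper r hr1, hXtop.eventually_gt_atTop 0] with y hy hXy
    exact ((div_le_iff₀ hXy).2 (csInf_le (hbdd y) hy)).trans_lt hr

theorem integral_one_sub_cos_of_charFun {α : ℝ} (hα0 : 0 < α) {μ : Measure ℝ} [IsFiniteMeasure μ]
    (hμ : ∀ t : ℝ,
      (Real.exp (-|t| ^ α) : ℂ) = ∫ x : ℝ, Complex.exp (Complex.I * t * x) ∂μ) (t : ℝ) :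
    ∫ y, (1 - Real.cos (t * y)) ∂μ = 1 - Real.exp (-|t| ^ α) := by
  have hcos : ∀ t : ℝ, ∫ y, Real.cos (t * y) ∂μ = Real.exp (-|t| ^ α) := by
    intro t
    have hi : Integrable (fun x : ℝ => Complex.exp (Complex.I * t * x)) μ := by
      refine Integrable.of_bound (C := 1) (by fun_prop) (ae_of_all _ fun x => ?_)
      rw [show Complex.I * t * x = ((t * x : ℝ) : ℂ) * Complex.I by push_cast; ring,
        Complex.norm_exp_ofReal_mul_I]
    have h1 := congrArg Complex.re (hμ t)
    rw [← Complex.reCLM_apply (∫ x : ℝ, _ ∂μ), ← Complex.reCLM.integral_comp_comm hi,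
      Complex.ofReal_re] at h1
    rw [h1]
    congr with x
    rw [show Complex.I * t * x = ((t * x : ℝ) : ℂ) * Complex.I by push_cast; ring,
      Complex.reCLM_apply, Complex.exp_ofReal_mul_I_re]
  have h0 := hcos 0
  simp only [zero_mul, Real.cos_zero, abs_zero, Real.zero_rpow hα0.ne', neg_zero,
    Real.exp_zero] at h0
  rw [integral_sub (integrable_const _), h0, hcos]
  exact Integrable.of_bound (C := 1) (by fun_prop) (ae_of_all _ fun y => Real.abs_cos_le_one _)

/-- for `0 < α < 2`, if `μ` is the spectral measure of the symmetric
`α`-stable characteristic function `e^{-|t|^α}`, then `μ([x,∞)) ~ C_α⁻¹ x^{-α}` as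
`x → ∞`; consequently `h(y) ~ (C_α y)^{-1/α}` as `y ↓ 0` and
`δ_u ~ C_α^{1/α} u^{-2/α}` as `u → ∞`, where `C_α = π/(Γ(α) sin(πα/2))`,
`h(y) = inf {x ≥ 0 : μ([x,∞)) ≤ y}` and `δ_u = (h(u⁻²))⁻¹`. -/
theorem excursion_stmt16
    (α : ℝ) (hα0 : 0 < α) (hα2 : α < 2)
    (μ : Measure ℝ) [IsFiniteMeasure μ]
    (hμ_nonnull : μ Set.univ ≠ 0)
    (hμ_symm : μ.map (fun x => -x) = μ)
    (hμ_char : ∀ t : ℝ,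
      (Real.exp (-|t| ^ α) : ℂ) = ∫ x : ℝ, Complex.exp (Complex.I * t * x) ∂μ)
    (h : ℝ → ℝ)
    (hh : ∀ y : ℝ, h y = sInf {x : ℝ | 0 ≤ x ∧ (μ (Set.Ici x)).toReal ≤ y})
    (δ : ℝ → ℝ)
    (hδ : ∀ u : ℝ, δ u = (h (u ^ (-2 : ℝ)))⁻¹) :
    Tendsto (fun x : ℝ => (μ (Set.Ici x)).toReal /
        ((Real.pi / (Real.Gamma α * Real.sin (Real.pi * α / 2)))⁻¹ * x ^ (-α)))
      atTop (nhds 1) ∧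
    Tendsto (fun y : ℝ => h y /
        ((Real.pi / (Real.Gamma α * Real.sin (Real.pi * α / 2)) * y) ^ (-α⁻¹)))
      (nhdsWithin 0 (Set.Ioi 0)) (nhds 1) ∧
    Tendsto (fun u : ℝ => δ u /
        ((Real.pi / (Real.Gamma α * Real.sin (Real.pi * α / 2))) ^ α⁻¹ * u ^ (-(2 / α))))
      atTop (nhds 1) := by
  have hC : 0 < Real.pi / (Real.Gamma α * Real.sin (Real.pi * α / 2)) := by
    have hΓ : 0 < Real.Gamma α := Real.Gamma_pos_of_pos hα0
    have hsin : 0 < Real.sin (Real.pi * α / 2) :=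
      Real.sin_pos_of_pos_of_lt_pi (by positivity) (by nlinarith [Real.pi_pos])
    positivity
  have htail : Tendsto (fun x : ℝ => x ^ α * (μ (Set.Ici x)).toReal) atTop
      (nhds (Real.pi / (Real.Gamma α * Real.sin (Real.pi * α / 2)))⁻¹) := by
    have h1 := (tendsto_rpow_mul_measureReal_le_abs hα0 hα2
      (integral_one_sub_cos_of_charFun hα0 hμ_char)).div_const 2
    rw [mul_div_cancel_left₀ _ (two_ne_zero' ℝ), ← inv_div] at h1
    refine h1.congr' ?_
    filter_upwards [eventually_gt_atTop 0] with x hx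
    rw [mul_div_assoc, ← measureReal_Ici_of_map_neg_eq hμ_symm hx, Measure.real]
  set C := Real.pi / (Real.Gamma α * Real.sin (Real.pi * α / 2))
  have hinv : Tendsto (fun y : ℝ => h y / (C * y) ^ (-α⁻¹))
      (nhdsWithin 0 (Set.Ioi 0)) (nhds 1) := by
    have hanti : Antitone fun x : ℝ => (μ (Set.Ici x)).toReal := fun x y hxy =>
      measureReal_mono (Set.Ici_subset_Ici.2 hxy)
    have h2 := tendsto_sInf_div_rpow hα0 (inv_pos.2 hC) hanti htail
    simpa only [inv_inv, ← hh] using h2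
  refine ⟨?_, hinv, ?_⟩
  · have h3 := htail.const_mul C
    rw [mul_inv_cancel₀ hC.ne'] at h3
    refine h3.congr' ?_
    filter_upwards [eventually_gt_atTop 0] with x hx
    rw [Real.rpow_neg hx.le]
    field_simp
  · have hu : Tendsto (fun u : ℝ => u ^ (-2 : ℝ)) atTop (nhdsWithin 0 (Set.Ioi 0)) :=
      tendsto_nhdsWithin_iff.2 ⟨tendsto_rpow_neg_atTop two_pos,
        (eventually_gt_atTop 0).mono fun u hu => Real.rpow_pos_of_pos hu _⟩
    have h4 := (hinv.comp hu).inv₀ one_ne_zero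
    rw [inv_one] at h4
    refine h4.congr' ?_
    filter_upwards [eventually_gt_atTop 0] with u hu0
    have h5 : (C * u ^ (-2 : ℝ)) ^ (-α⁻¹) = (C ^ α⁻¹ * u ^ (-(2 / α)))⁻¹ := by
      rw [Real.rpow_neg (by positivity), Real.mul_rpow hC.le (by positivity),
        ← Real.rpow_mul hu0.le]
      congr 3
      ring
    rw [Function.comp_apply, h5, hδ, inv_div, div_eq_mul_inv, inv_mul_eq_div, div_eq_mul_inv,
      div_eq_mul_inv, mul_comm]
end

section
/- Let (X_t : t ∈ ℝ) be a zero-mean stationary Gaussian process with continuous paths and Cov(X_s, X_t) = e^{−|s−t|²} (the case α = 2). Define τ_u^+ = inf{t ≥ 0 : X_t ≤ u} and τ_u^- = sup{t ≤ 0 : X_t ≤ u}. Then, conditionally on [X_0 > u], as u → ∞, u(τ_u^+ − τ_u^-) converges in distribution to √(2(Z² + 2T*)), where Z is standard normal and T* is standard exponential, independent of each other. -/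
open MeasureTheory ProbabilityTheory Filter

/-- A real-valued stochastic process is a (zero-mean) Gaussian process if every finite
linear combination of its values has a centered Gaussian distribution. -/
def IsZeroMeanGaussianProcess {Ω : Type*} [MeasurableSpace Ω] (P : Measure Ω)
    (X : ℝ → Ω → ℝ) : Prop :=
  (∀ t, Measurable (X t)) ∧
  ∀ (n : ℕ) (t : Fin n → ℝ) (c : Fin n → ℝ),
    ∃ v : NNReal, P.map (fun ω => ∑ i, c i * X (t i) ω) = gaussianReal 0 v

/-- The first time a continuous path reaches the level `u`, computed from its values at rational
times; it is `⊤` when the path stays above `u`. -/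
noncomputable def rationalHittingTime (u : ℝ) (x : ℚ → ℝ) : ENNReal :=
  ⨆ k : ℕ, ⨅ q : ℚ, if 0 ≤ q ∧ x q < u + 1 / ((k : ℝ) + 1) then ENNReal.ofReal q else ⊤

lemma measurable_rationalHittingTime (u : ℝ) : Measurable (rationalHittingTime u) := by
  unfold rationalHittingTime
  refine Measurable.iSup fun k => Measurable.iInf fun q => ?_
  refine Measurable.ite ?_ measurable_const measurable_const
  by_cases hq : 0 ≤ q
  · simp only [hq, true_and]
    exact measurableSet_lt (measurable_pi_apply q) measurable_const
  · simp [hq]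

lemma ofReal_le_rationalHittingTime {u : ℝ} {x : ℝ → ℝ} (hx : Continuous x) {M : ℝ}
    (hM : 0 ≤ M) (h : ∀ t, 0 ≤ t → t ≤ M → u < x t) :
    ENNReal.ofReal M ≤ rationalHittingTime u fun q => x q := by
  obtain ⟨t₀, ht₀, hmin⟩ := (isCompact_Icc (a := (0 : ℝ)) (b := M)).exists_isMinOn
    ⟨0, le_rfl, hM⟩ hx.continuousOn
  obtain ⟨k, hk⟩ := exists_nat_one_div_lt (sub_pos.2 (h t₀ ht₀.1 ht₀.2))
  refine le_iSup_of_le k (le_iInf fun q => ?_)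
  split_ifs with hq
  · refine ENNReal.ofReal_le_ofReal ?_
    by_contra! hlt
    have := isMinOn_iff.1 hmin q ⟨by exact_mod_cast hq.1, hlt.le⟩
    linarith [hq.2]
  · exact le_top

lemma sInf_eq_toReal_rationalHittingTime {x : ℝ → ℝ} (hx : Continuous x) (u : ℝ) :
    sInf {t : ℝ | 0 ≤ t ∧ x t ≤ u} = (rationalHittingTime u fun q => x q).toReal := by
  set A := {t : ℝ | 0 ≤ t ∧ x t ≤ u} with hA
  have hbdd : BddBelow A := ⟨0, fun t ht => ht.1⟩
  rcases A.eq_empty_or_nonempty with hE | hne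
  · have htop : (rationalHittingTime u fun q => x q) = ⊤ := by
      refine ENNReal.eq_top_of_forall_nnreal_le fun r => ?_
      rw [← ENNReal.ofReal_coe_nnreal]
      refine ofReal_le_rationalHittingTime hx r.coe_nonneg fun t ht _ => ?_
      by_contra! hle
      exact (hE ▸ (⟨ht, hle⟩ : t ∈ A) : t ∈ (∅ : Set ℝ))
    rw [hE, htop]
    simp
  · have hclosed : IsClosed A :=
      (isClosed_le continuous_const continuous_id).inter (isClosed_le hx continuous_const)
    obtain ⟨hτ0, hτu⟩ : sInf A ∈ A := hclosed.csInf_mem hne hbdd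
    have hle : (rationalHittingTime u fun q => x q) ≤ ENNReal.ofReal (sInf A) := by
      refine iSup_le fun k => ENNReal.le_of_forall_pos_le_add fun ε hε _ => ?_
      have hk : (0 : ℝ) < 1 / ((k : ℝ) + 1) := by positivity
      have hev : ∀ᶠ t in nhdsWithin (sInf A) (Set.Ioi (sInf A)),
          x t < u + 1 / ((k : ℝ) + 1) ∧ t < sInf A + ε := by
        refine Filter.Eventually.filter_mono nhdsWithin_le_nhds (Filter.Eventually.and ?_ ?_)
        · exact hx.continuousAt.eventually_lt_const (by linarith)
        · exact eventually_lt_nhds (by simpa using hε)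
      obtain ⟨b, hb, hb'⟩ := (mem_nhdsGT_iff_exists_Ioo_subset).1 hev
      obtain ⟨q, hq1, hq2⟩ := exists_rat_btwn (Set.mem_Ioi.1 hb)
      obtain ⟨h1, h2⟩ := hb' ⟨hq1, hq2⟩
      refine (iInf_le _ q).trans ?_
      rw [if_pos ⟨by exact_mod_cast hτ0.trans hq1.le, h1⟩]
      refine (ENNReal.ofReal_le_ofReal h2.le).trans ?_
      rw [ENNReal.ofReal_add hτ0 ε.coe_nonneg, ENNReal.ofReal_coe_nnreal]
    have hge : ENNReal.ofReal (sInf A) ≤ rationalHittingTime u fun q => x q := by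
      refine le_of_forall_lt fun c hc => ?_
      obtain ⟨d, hcd, hd⟩ := exists_between hc
      have hdtop : d ≠ ⊤ := ne_top_of_lt hd
      refine hcd.trans_le ?_
      rw [← ENNReal.ofReal_toReal hdtop]
      refine ofReal_le_rationalHittingTime hx ENNReal.toReal_nonneg fun t ht htd => ?_
      by_contra! hle
      have h1 : sInf A ≤ t := csInf_le hbdd ⟨ht, hle⟩
      exact absurd hd (not_lt.2 ((ENNReal.ofReal_le_ofReal (h1.trans htd)).trans
        (ENNReal.ofReal_toReal hdtop).le))
    rw [le_antisymm hle hge, ENNReal.toReal_ofReal hτ0]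

lemma sSup_nonpos_eq_neg_sInf (x : ℝ → ℝ) (u : ℝ) :
    sSup {t : ℝ | t ≤ 0 ∧ x t ≤ u} = -sInf {t : ℝ | 0 ≤ t ∧ x (-t) ≤ u} := by
  rw [Real.sInf_def, neg_neg]
  congr 1
  ext t
  simp

lemma exp_neg_sq_mul_le_iff {u e t y : ℝ} (hu : 0 < u) :
    Real.exp (-t ^ 2) * (u + e / u + y) ≤ u ↔
      e + u * y - u ^ 2 * (Real.exp (t ^ 2) - 1) ≤ 0 := by
  rw [Real.exp_neg, inv_mul_le_iff₀ (Real.exp_pos _), ← mul_le_mul_iff_right₀ hu]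
  have : u * (u + e / u + y) = u ^ 2 + e + u * y := by field_simp
  rw [this]
  constructor <;> intro h <;> nlinarith

/-- Rescaled first passage below `u` of a smooth path that starts at `u + p * m / u` with slope
`p - m`: the path looks like the parabola `s ↦ (p - s) * (s + m)`. -/
lemma tendsto_mul_sInf_passage {S : ℝ → ℝ} (hS : ContinuousAt S 0) {p m : ℝ} (hp : 0 < p)
    (hm : 0 < m) (hS0 : S 0 = p - m) :
    Tendsto (fun u : ℝ => u * sInf {t : ℝ | 0 ≤ t ∧
      Real.exp (-t ^ 2) * (u + p * m / u + t * S t) ≤ u}) atTop (nhds p) := by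
  rw [ContinuousAt, hS0] at hS
  have hupper : ∀ a, p < a → ∀ᶠ u : ℝ in atTop,
      0 ≤ a / u ∧ Real.exp (-(a / u) ^ 2) * (u + p * m / u + a / u * S (a / u)) ≤ u := by
    intro a ha
    have h1 : Tendsto (fun u : ℝ => p * m + a * S (a / u) - a ^ 2) atTop
        (nhds (p * m + a * (p - m) - a ^ 2)) :=
      ((hS.comp (tendsto_id.const_div_atTop a)).const_mul a).const_add _ |>.sub_const _
    have h2 : p * m + a * (p - m) - a ^ 2 < 0 := by nlinarith
    filter_upwards [h1.eventually_lt_const h2, eventually_gt_atTop 0] with u h hu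
    refine ⟨by have := hp.trans ha; positivity, (exp_neg_sq_mul_le_iff hu).2 ?_⟩
    have h3 : (a / u) ^ 2 + 1 ≤ Real.exp ((a / u) ^ 2) := Real.add_one_le_exp _
    have h4 : a ^ 2 ≤ u ^ 2 * (Real.exp ((a / u) ^ 2) - 1) := by
      calc a ^ 2 = u ^ 2 * ((a / u) ^ 2) := by field_simp
        _ ≤ _ := by gcongr; linarith
    have h5 : u * (a / u * S (a / u)) = a * S (a / u) := by field_simp
    rw [h5]
    linarith
  have hlower : ∀ ε, 0 < ε → ∀ᶠ u : ℝ in atTop, ∀ t, 0 ≤ t → u * t ≤ p - ε →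
      u < Real.exp (-t ^ 2) * (u + p * m / u + t * S t) := by
    intro ε hε
    have hδ : 0 < ε * m / (2 * p) := by positivity
    obtain ⟨η, hη, hη'⟩ := Metric.tendsto_nhds_nhds.1 hS _ hδ
    have e1 : ∀ᶠ u : ℝ in atTop, p / u < η :=
      (tendsto_id.const_div_atTop p).eventually_lt_const hη
    have e2 : ∀ᶠ u : ℝ in atTop, p / u < 1 :=
      (tendsto_id.const_div_atTop p).eventually_lt_const one_pos
    have e3 : ∀ᶠ u : ℝ in atTop, p ^ 4 / u ^ 2 < ε * m / 2 :=
      ((tendsto_pow_atTop two_ne_zero).const_div_atTop (p ^ 4)).eventually_lt_const (by positivity)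
    filter_upwards [e1, e2, e3, eventually_gt_atTop 0] with u h1 h2 h3 hu t ht hs
    rw [← not_le, exp_neg_sq_mul_le_iff hu, not_le]
    set s := u * t with hsdef
    have hs0 : 0 ≤ s := by positivity
    have hst : t = s / u := by rw [hsdef]; field_simp
    have htp : t ≤ p / u := by
      rw [hst]
      gcongr
      linarith
    have hSt : p - m - ε * m / (2 * p) < S t := by
      have := hη' (x := t) (by
        rw [Real.dist_eq, sub_zero, abs_of_nonneg ht]
        linarith)
      rw [Real.dist_eq] at this
      linarith [(abs_lt.1 this).1]
    have h5 : u ^ 2 * (Real.exp (t ^ 2) - 1) ≤ s ^ 2 + p ^ 4 / u ^ 2 := by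
      have ht1 : t ^ 2 ≤ 1 := by nlinarith
      have h6 := Real.abs_exp_sub_one_sub_id_le (x := t ^ 2) (by rwa [abs_of_nonneg (sq_nonneg t)])
      have h7 : Real.exp (t ^ 2) - 1 ≤ t ^ 2 + (t ^ 2) ^ 2 := by linarith [(abs_le.1 h6).2]
      calc u ^ 2 * (Real.exp (t ^ 2) - 1) ≤ u ^ 2 * (t ^ 2 + (t ^ 2) ^ 2) := by gcongr
        _ = s ^ 2 + u ^ 2 * (t ^ 2) ^ 2 := by rw [hsdef]; ring
        _ ≤ s ^ 2 + u ^ 2 * ((p / u) ^ 2) ^ 2 := by gcongr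
        _ = s ^ 2 + p ^ 4 / u ^ 2 := by field_simp
    have h8 : s * (ε * m / (2 * p)) ≤ ε * m / 2 := by
      calc s * (ε * m / (2 * p)) ≤ p * (ε * m / (2 * p)) := by gcongr; linarith
        _ = ε * m / 2 := by field_simp
    have h9 : u * (t * S t) = s * S t := by rw [hsdef]; ring
    have h10 : s * (p - m - ε * m / (2 * p)) ≤ s * S t := by gcongr
    have h11 : ε * m ≤ (p - s) * (s + m) := by nlinarith
    rw [h9]
    nlinarith
  refine tendsto_order.2 ⟨fun a ha => ?_, fun a ha => ?_⟩
  · filter_upwards [hlower ((p - a) / 2) (by linarith), hupper (p + 1) (by linarith),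
      eventually_gt_atTop 0] with u h1 h2 hu
    have : (p + a) / 2 / u ≤ sInf {t : ℝ | 0 ≤ t ∧
        Real.exp (-t ^ 2) * (u + p * m / u + t * S t) ≤ u} := by
      refine le_csInf ⟨_, h2⟩ fun t ht => ?_
      by_contra! hlt
      rw [lt_div_iff₀ hu] at hlt
      exact absurd ht.2 (not_le.2 (h1 t ht.1 (by linarith)))
    rw [div_le_iff₀ hu] at this
    linarith
  · filter_upwards [hupper ((p + a) / 2) (by linarith), eventually_gt_atTop 0] with u h2 hu
    have : sInf {t : ℝ | 0 ≤ t ∧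
        Real.exp (-t ^ 2) * (u + p * m / u + t * S t) ≤ u} ≤ (p + a) / 2 / u :=
      csInf_le ⟨0, fun t ht => ht.1⟩ h2
    rw [le_div_iff₀ hu] at this
    linarith

lemma tendsto_mul_excursion_length {S : ℝ → ℝ} (hS : ContinuousAt S 0) {e : ℝ} (he : 0 < e) :
    Tendsto (fun u : ℝ => u *
        (sInf {t : ℝ | 0 ≤ t ∧ Real.exp (-t ^ 2) * (u + e / u + t * S t) ≤ u}
          - sSup {t : ℝ | t ≤ 0 ∧ Real.exp (-t ^ 2) * (u + e / u + t * S t) ≤ u})) atTop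
      (nhds (Real.sqrt (S 0 ^ 2 + 4 * e))) := by
  set r := Real.sqrt (S 0 ^ 2 + 4 * e) with hr
  have hr2 : r ^ 2 = S 0 ^ 2 + 4 * e := Real.sq_sqrt (by positivity)
  have hlt : |S 0| < r := Real.lt_sqrt_of_sq_lt (by rw [sq_abs]; linarith)
  obtain ⟨h1, h2⟩ := abs_lt.1 hlt
  set p := (r + S 0) / 2 with hp
  set m := (r - S 0) / 2 with hm
  have hpm : p * m = e := by rw [hp, hm]; linarith
  have H1 := tendsto_mul_sInf_passage hS (p := p) (m := m) (by linarith) (by linarith)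
    (by rw [hp, hm]; ring)
  have hS' : ContinuousAt (fun t => -S (-t)) 0 := by
    refine (ContinuousAt.comp (g := S) (f := fun t : ℝ => -t) ?_ continuous_neg.continuousAt).neg
    simpa using hS
  have H2 := tendsto_mul_sInf_passage hS' (p := m) (m := p) (by linarith) (by linarith)
    (by rw [hp, hm, neg_zero]; ring)
  rw [hpm] at H1
  rw [mul_comm m p, hpm] at H2
  have H := H1.add H2
  rw [show p + m = r by rw [hp, hm]; ring] at H
  refine H.congr fun u => ?_
  rw [sSup_nonpos_eq_neg_sInf (fun t => Real.exp (-t ^ 2) * (u + e / u + t * S t)), sub_neg_eq_add,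
    mul_add]
  simp only [neg_sq, mul_neg, neg_mul]

/-- The law of an i.i.d. sequence of standard normal variables. -/
noncomputable abbrev gaussianSeq : Measure (ℕ → ℝ) :=
  Measure.infinitePi fun _ => gaussianReal 0 1

lemma charFun_finset_sum_gaussianSeq (a : ℕ → ℝ) (s : Finset ℕ) :
    ∫ ω, Complex.exp ((∑ n ∈ s, a n * ω n : ℝ) * Complex.I) ∂gaussianSeq =
      Complex.exp (-(∑ n ∈ s, a n ^ 2 : ℝ) / 2) := by
  have hind : iIndepFun (fun n (ω : ℕ → ℝ) => a n * ω n) gaussianSeq :=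
    iIndepFun_infinitePi (X := fun n x => a n * x) (fun n => by fun_prop)
  have h := congrFun ((hind.restrict s).charFun_map_fun_finsetSum_eq_prod (s := s)
    (fun i _ => (by fun_prop : Measurable fun ω : ℕ → ℝ => a i * ω i).aemeasurable)) 1
  rw [charFun_apply_real, integral_map (Measurable.aemeasurable (by fun_prop))
    (Continuous.aestronglyMeasurable (by fun_prop))] at h
  simp only [Complex.ofReal_one, one_mul] at h
  rw [h, Finset.prod_apply]
  have hlaw : ∀ n, charFun (gaussianSeq.map (fun ω : ℕ → ℝ => a n * ω n)) 1 =
      Complex.exp (-(a n ^ 2 : ℝ) / 2) := by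
    intro n
    rw [charFun_map_mul_comp (Measurable.aemeasurable (by fun_prop)), Measure.infinitePi_map_eval,
      charFun_gaussianReal]
    simp [neg_div]
  simp_rw [hlaw]
  rw [← Complex.exp_sum]
  congr 1
  push_cast
  rw [neg_div, Finset.sum_div, ← Finset.sum_neg_distrib]
  simp [neg_div]

lemma charFun_hasSum_gaussianSeq {a : ℕ → ℝ} {V : ℝ} (hV : HasSum (fun n => a n ^ 2) V)
    {T : (ℕ → ℝ) → ℝ} (hT : ∀ᵐ ω ∂gaussianSeq, HasSum (fun n => a n * ω n) (T ω)) :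
    ∫ ω, Complex.exp (T ω * Complex.I) ∂gaussianSeq = Complex.exp (-V / 2) := by
  have h1 : Tendsto (fun N : ℕ => ∫ ω, Complex.exp ((∑ n ∈ Finset.range N, a n * ω n : ℝ) *
      Complex.I) ∂gaussianSeq) atTop (nhds (∫ ω, Complex.exp (T ω * Complex.I) ∂gaussianSeq)) := by
    refine tendsto_integral_of_dominated_convergence (fun _ => 1)
      (fun N => ?_) (integrable_const _) (fun N => ?_) ?_
    · exact Continuous.aestronglyMeasurable (by fun_prop)
    · exact ae_of_all _ fun ω => (Complex.norm_exp_ofReal_mul_I _).le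
    · filter_upwards [hT] with ω hω
      have hc : Continuous fun x : ℝ => Complex.exp (x * Complex.I) := by fun_prop
      exact (hc.tendsto _).comp hω.tendsto_sum_nat
  have h2 : Tendsto (fun N : ℕ => Complex.exp (-(∑ n ∈ Finset.range N, a n ^ 2 : ℝ) / 2)) atTop
      (nhds (Complex.exp (-V / 2))) := by
    have hc : Continuous fun x : ℝ => Complex.exp (-x / 2) := by fun_prop
    exact (hc.tendsto _).comp hV.tendsto_sum_nat
  simp_rw [charFun_finset_sum_gaussianSeq] at h1
  exact tendsto_nhds_unique h1 h2

/-- Sequences that grow at most like `2 ^ n`. -/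
def expGrowth : Set (ℕ → ℝ) := {ω | ∃ C : ℕ, ∀ n, |ω n| ≤ C * 2 ^ n}

lemma measurableSet_expGrowth : MeasurableSet expGrowth := by
  have : expGrowth = ⋃ C : ℕ, ⋂ n : ℕ, {ω | |ω n| ≤ (C : ℝ) * 2 ^ n} := by
    ext ω
    simp [expGrowth]
  rw [this]
  refine MeasurableSet.iUnion fun C => MeasurableSet.iInter fun n => ?_
  exact measurableSet_le (measurable_pi_apply n).abs measurable_const

lemma ae_mem_expGrowth : ∀ᵐ ω ∂gaussianSeq, ω ∈ expGrowth := by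
  have hfin : ∫⁻ x, ‖x‖ₑ ∂(gaussianReal 0 1) ≠ ⊤ :=
    ((memLp_id_gaussianReal (μ := 0) (v := 1) 1).integrable le_rfl).2.ne
  have hint : ∫⁻ ω, ∑' n, ‖ω n‖ₑ * (2⁻¹ : ENNReal) ^ n ∂gaussianSeq ≠ ⊤ := by
    rw [lintegral_tsum fun n => Measurable.aemeasurable (by fun_prop)]
    have : ∀ n : ℕ, ∫⁻ ω, ‖ω n‖ₑ * (2⁻¹ : ENNReal) ^ n ∂gaussianSeq =
        (∫⁻ x, ‖x‖ₑ ∂(gaussianReal 0 1)) * 2⁻¹ ^ n := by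
      intro n
      rw [lintegral_mul_const _ (by fun_prop)]
      congr 1
      exact (measurePreserving_eval_infinitePi (fun _ => gaussianReal 0 1) n).lintegral_comp
        (f := fun x => ‖x‖ₑ) (by fun_prop)
    simp_rw [this]
    rw [ENNReal.tsum_mul_left, ENNReal.tsum_geometric]
    refine ENNReal.mul_ne_top hfin ?_
    rw [ENNReal.one_sub_inv_two, inv_inv]
    exact ENNReal.ofNat_ne_top
  filter_upwards [ae_lt_top (by fun_prop) hint] with ω hω
  obtain ⟨C, hC⟩ := exists_nat_ge (∑' n, ‖ω n‖ₑ * (2⁻¹ : ENNReal) ^ n).toReal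
  refine ⟨C, fun n => ?_⟩
  have h1 := ENNReal.toReal_mono hω.ne (ENNReal.le_tsum (f := fun n => ‖ω n‖ₑ * 2⁻¹ ^ n) n)
  simp only [ENNReal.toReal_mul, toReal_enorm, Real.norm_eq_abs, ENNReal.toReal_pow,
    ENNReal.toReal_inv, ENNReal.toReal_ofNat] at h1
  have h2 := h1.trans hC
  rwa [inv_pow, ← div_eq_mul_inv, div_le_iff₀ (by positivity)] at h2

/-- A sequence, replaced by zero unless it grows at most like `2 ^ n`. -/
noncomputable def tameSeq (ω : ℕ → ℝ) : ℕ → ℝ := expGrowth.indicator id ω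

lemma measurable_tameSeq : Measurable tameSeq :=
  measurable_id.indicator measurableSet_expGrowth

lemma tameSeq_of_mem {ω : ℕ → ℝ} (h : ω ∈ expGrowth) : tameSeq ω = ω :=
  Set.indicator_of_mem h _

lemma tameSeq_mem_expGrowth (ω : ℕ → ℝ) : tameSeq ω ∈ expGrowth := by
  by_cases h : ω ∈ expGrowth
  · rwa [tameSeq_of_mem h]
  · rw [tameSeq, Set.indicator_of_notMem h]
    exact ⟨0, by simp⟩

/-- The coefficients `√(2 ^ (n + 1) / (n + 1)!)`. -/
noncomputable def hermiteCoeff (n : ℕ) : ℝ :=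
  Real.sqrt (2 ^ (n + 1) / (n + 1).factorial)

lemma hermiteCoeff_nonneg (n : ℕ) : 0 ≤ hermiteCoeff n := Real.sqrt_nonneg _

lemma hermiteCoeff_sq (n : ℕ) : hermiteCoeff n ^ 2 = 2 ^ (n + 1) / (n + 1).factorial :=
  Real.sq_sqrt (by positivity)

lemma summable_hermiteCoeff_mul_pow (r : ℝ) : Summable fun n => hermiteCoeff n * r ^ n := by
  have hs : Summable fun n : ℕ => 2 * ((8 * r ^ 2) ^ n / n.factorial) + (1 / 4 : ℝ) ^ n :=
    ((Real.summable_pow_div_factorial _).mul_left 2).add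
      (summable_geometric_of_lt_one (by norm_num) (by norm_num))
  refine Summable.of_norm_bounded hs fun n => ?_
  have h1 : (hermiteCoeff n * (2 * |r|) ^ n) ^ 2 ≤ 2 * ((8 * r ^ 2) ^ n / n.factorial) := by
    have h2 : (hermiteCoeff n * (2 * |r|) ^ n) ^ 2 =
        2 * ((8 * r ^ 2) ^ n / (n + 1).factorial) := by
      rw [mul_pow, hermiteCoeff_sq, ← pow_mul, mul_comm n 2, pow_mul, mul_pow 2 |r|, sq_abs,
        show 8 * r ^ 2 = 2 * (2 ^ 2 * r ^ 2) by ring, mul_pow 2 (2 ^ 2 * r ^ 2)]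
      ring
    rw [h2]
    gcongr
    omega
  have h3 : ‖hermiteCoeff n * r ^ n‖ = hermiteCoeff n * (2 * |r|) ^ n * (1 / 2) ^ n := by
    rw [norm_mul, norm_pow, Real.norm_of_nonneg (hermiteCoeff_nonneg n), Real.norm_eq_abs,
      mul_assoc, ← mul_pow]
    ring_nf
  have h4 : ((1 / 2 : ℝ) ^ n) ^ 2 = (1 / 4) ^ n := by
    rw [← pow_mul, mul_comm, pow_mul]
    norm_num
  rw [h3]
  nlinarith [sq_nonneg (hermiteCoeff n * (2 * |r|) ^ n - (1 / 2) ^ n),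
    sq_nonneg (hermiteCoeff n * (2 * |r|) ^ n + (1 / 2) ^ n)]

/-- The random power series `∑ √(2 ^ (n + 1) / (n + 1)!) ωₙ tⁿ`. -/
noncomputable def slopeSeries (ω : ℕ → ℝ) (t : ℝ) : ℝ :=
  ∑' n, hermiteCoeff n * t ^ n * tameSeq ω n

lemma exists_slopeSeries_bound (ω : ℕ → ℝ) (R : ℝ) : ∃ b : ℕ → ℝ, Summable b ∧
    ∀ n, ∀ t, |t| ≤ R → ‖hermiteCoeff n * t ^ n * tameSeq ω n‖ ≤ b n := by
  obtain ⟨C, hC⟩ := tameSeq_mem_expGrowth ω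
  refine ⟨_, (summable_hermiteCoeff_mul_pow (2 * R)).mul_left (C : ℝ), fun n t ht => ?_⟩
  rw [norm_mul, norm_mul, norm_pow, Real.norm_of_nonneg (hermiteCoeff_nonneg n),
    Real.norm_eq_abs, Real.norm_eq_abs]
  have := hermiteCoeff_nonneg n
  have hR : 0 ≤ R := (abs_nonneg t).trans ht
  calc hermiteCoeff n * |t| ^ n * |tameSeq ω n|
      ≤ hermiteCoeff n * R ^ n * (C * 2 ^ n) := by gcongr; exact hC n
    _ = C * (hermiteCoeff n * (2 * R) ^ n) := by rw [mul_pow]; ring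

lemma hasSum_slopeSeries (ω : ℕ → ℝ) (t : ℝ) :
    HasSum (fun n => hermiteCoeff n * t ^ n * tameSeq ω n) (slopeSeries ω t) := by
  obtain ⟨b, hb, h⟩ := exists_slopeSeries_bound ω |t|
  exact (Summable.of_norm_bounded hb fun n => h n t le_rfl).hasSum

lemma continuous_slopeSeries (ω : ℕ → ℝ) : Continuous (slopeSeries ω) := by
  refine continuous_iff_continuousAt.2 fun t₀ => ?_
  obtain ⟨b, hb, h⟩ := exists_slopeSeries_bound ω (|t₀| + 1)
  have hon : ContinuousOn (slopeSeries ω) {t | |t| ≤ |t₀| + 1} :=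
    continuousOn_tsum (fun n => by fun_prop) hb fun n t ht => h n t ht
  refine hon.continuousAt (Filter.mem_of_superset ((isOpen_lt continuous_abs continuous_const
    (g := fun _ => |t₀| + 1)).mem_nhds (by simp : |t₀| < |t₀| + 1)) fun t (ht : |t| < _) => ht.le)

lemma slopeSeries_zero (ω : ℕ → ℝ) : slopeSeries ω 0 = Real.sqrt 2 * tameSeq ω 0 := by
  rw [slopeSeries, tsum_eq_single 0 fun n hn => by simp [hn]]
  simp [hermiteCoeff]

lemma measurable_slopeSeries (t : ℝ) : Measurable fun ω => slopeSeries ω t := by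
  refine measurable_of_tendsto_metrizable
    (f := fun N ω => ∑ n ∈ Finset.range N, hermiteCoeff n * t ^ n * tameSeq ω n) (fun N => ?_)
    (tendsto_pi_nhds.2 fun ω => (hasSum_slopeSeries ω t).tendsto_sum_nat)
  refine Finset.measurable_sum _ fun n _ => measurable_const.mul ?_
  exact (measurable_pi_apply n).comp measurable_tameSeq

/-- A stationary Gaussian process with covariance `exp (-(s - t) ^ 2)` and analytic paths, realized
on the space of i.i.d. standard normal variables `z.1, z.2 0, z.2 1, …`. -/
noncomputable def analyticProcess (t : ℝ) (z : ℝ × (ℕ → ℝ)) : ℝ :=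
  Real.exp (-t ^ 2) * (z.1 + t * slopeSeries z.2 t)

lemma measurable_analyticProcess (t : ℝ) : Measurable (analyticProcess t) :=
  measurable_const.mul (measurable_fst.add
    (measurable_const.mul ((measurable_slopeSeries t).comp measurable_snd)))

lemma continuous_analyticProcess (z : ℝ × (ℕ → ℝ)) : Continuous fun t => analyticProcess t z := by
  have := continuous_slopeSeries z.2
  unfold analyticProcess
  fun_prop

lemma charFun_analyticProcess {ι : Type*} [Fintype ι] (t c : ι → ℝ) :
    ∫ z, Complex.exp ((∑ i, c i * analyticProcess (t i) z : ℝ) * Complex.I)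
        ∂((gaussianReal 0 1).prod gaussianSeq) =
      Complex.exp (-(∑ i, ∑ j, c i * c j * Real.exp (-|t i - t j| ^ 2) : ℝ) / 2) := by
  set A : ℝ := ∑ i, c i * Real.exp (-t i ^ 2) with hA
  set T : (ℕ → ℝ) → ℝ := fun ω => ∑ i, c i * Real.exp (-t i ^ 2) * t i * slopeSeries ω (t i)
    with hT
  set a : ℕ → ℝ := fun n => ∑ i, c i * Real.exp (-t i ^ 2) * t i * (hermiteCoeff n * t i ^ n)
    with ha
  have hdecomp : ∀ z : ℝ × (ℕ → ℝ), Complex.exp ((∑ i, c i * analyticProcess (t i) z : ℝ) *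
      Complex.I) = Complex.exp ((A * z.1 : ℝ) * Complex.I) * Complex.exp (T z.2 * Complex.I) := by
    intro z
    rw [← Complex.exp_add, ← add_mul, ← Complex.ofReal_add]
    congr 3
    rw [hA, hT, Finset.sum_mul, ← Finset.sum_add_distrib]
    refine Finset.sum_congr rfl fun i _ => ?_
    rw [analyticProcess]
    ring
  simp_rw [hdecomp]
  rw [integral_prod_mul (fun x : ℝ => Complex.exp ((A * x : ℝ) * Complex.I))
    (fun ω => Complex.exp (T ω * Complex.I))]
  have h1 : ∫ x, Complex.exp ((A * x : ℝ) * Complex.I) ∂(gaussianReal 0 1) =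
      Complex.exp (-(A ^ 2 : ℝ) / 2) := by
    have := charFun_gaussianReal (μ := 0) (v := 1) A
    rw [charFun_apply_real] at this
    push_cast
    rw [this]
    simp [neg_div]
  have hTsum : ∀ᵐ ω ∂gaussianSeq, HasSum (fun n => a n * ω n) (T ω) := by
    filter_upwards [ae_mem_expGrowth] with ω hω
    have : ∀ n, a n * ω n = ∑ i, c i * Real.exp (-t i ^ 2) * t i *
        (hermiteCoeff n * t i ^ n * tameSeq ω n) := by
      intro n
      rw [ha, tameSeq_of_mem hω, Finset.sum_mul]
      exact Finset.sum_congr rfl fun i _ => by ring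
    simp_rw [this]
    exact hasSum_sum fun i _ => (hasSum_slopeSeries ω (t i)).mul_left _
  have hVsum : HasSum (fun n => a n ^ 2)
      (∑ i, ∑ j, c i * c j * Real.exp (-|t i - t j| ^ 2) - A ^ 2) := by
    have hexp : ∀ i j, HasSum (fun n => c i * Real.exp (-t i ^ 2) * (c j * Real.exp (-t j ^ 2)) *
        ((2 * t i * t j) ^ (n + 1) / (n + 1).factorial))
        (c i * c j * Real.exp (-|t i - t j| ^ 2) -
          c i * Real.exp (-t i ^ 2) * (c j * Real.exp (-t j ^ 2))) := by
      intro i j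
      have h := (NormedSpace.expSeries_div_hasSum_exp (2 * t i * t j))
      rw [← Real.exp_eq_exp_ℝ, ← hasSum_nat_add_iff' 1] at h
      have h' := h.mul_left (c i * Real.exp (-t i ^ 2) * (c j * Real.exp (-t j ^ 2)))
      convert! h' using 1
      simp only [Finset.range_one, Finset.sum_singleton, pow_zero, Nat.factorial_zero,
        Nat.cast_one, div_one]
      have he : Real.exp (-|t i - t j| ^ 2) =
          Real.exp (-t i ^ 2) * Real.exp (-t j ^ 2) * Real.exp (2 * t i * t j) := by
        rw [← Real.exp_add, ← Real.exp_add, sq_abs]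
        ring_nf
      rw [he]
      ring
    have hsum := hasSum_sum (s := Finset.univ) fun i _ =>
      hasSum_sum (s := Finset.univ) fun j _ => hexp i j
    convert! hsum using 1
    · ext n
      rw [ha, sq, Finset.sum_mul_sum]
      refine Finset.sum_congr rfl fun i _ => Finset.sum_congr rfl fun j _ => ?_
      have := hermiteCoeff_sq n
      calc _ = c i * Real.exp (-t i ^ 2) * (c j * Real.exp (-t j ^ 2)) * (t i * t j) ^ (n + 1) *
            hermiteCoeff n ^ 2 := by ring
        _ = _ := by
          rw [this, mul_assoc 2, mul_pow 2]
          ring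
    · simp_rw [Finset.sum_sub_distrib]
      rw [sq, hA, Finset.sum_mul_sum]
  rw [h1, charFun_hasSum_gaussianSeq hVsum hTsum, ← Complex.exp_add]
  congr 1
  push_cast
  ring

lemma IsZeroMeanGaussianProcess.charFun {Ω : Type*} [MeasurableSpace Ω] {P : Measure Ω}
    {X : ℝ → Ω → ℝ} (hX : IsZeroMeanGaussianProcess P X) {K : ℝ → ℝ → ℝ}
    (hK : ∀ s t, ∫ ω, X s ω * X t ω ∂P = K s t)
    {ι : Type*} [Fintype ι] (t c : ι → ℝ) :
    ∫ ω, Complex.exp ((∑ i, c i * X (t i) ω : ℝ) * Complex.I) ∂P =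
      Complex.exp (-(∑ i, ∑ j, c i * c j * K (t i) (t j) : ℝ) / 2) := by
  have hmem : ∀ s, MemLp (X s) 2 P := by
    intro s
    obtain ⟨v, hv⟩ := hX.2 1 (fun _ => s) (fun _ => 1)
    simp only [Finset.univ_unique, one_mul, Finset.sum_const, Finset.card_singleton,
      one_smul] at hv
    have := memLp_id_gaussianReal (μ := 0) (v := v) 2
    rw [← hv, memLp_map_measure_iff (by fun_prop) (hX.1 s).aemeasurable] at this
    simpa using this
  set Y : Ω → ℝ := fun ω => ∑ i, c i * X (t i) ω with hY
  have hYm : Measurable Y := by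
    have := hX.1
    exact Finset.measurable_sum _ fun i _ => (hX.1 _).const_mul _
  obtain ⟨v, hv⟩ : ∃ v : NNReal, P.map Y = gaussianReal 0 v := by
    let e := Fintype.equivFin ι
    obtain ⟨v, hv⟩ := hX.2 (Fintype.card ι) (t ∘ e.symm) (c ∘ e.symm)
    refine ⟨v, ?_⟩
    rw [← hv]
    congr 1
    ext ω
    exact (e.symm.sum_comp fun i => c i * X (t i) ω).symm
  have hvar : (v : ℝ) = ∑ i, ∑ j, c i * c j * K (t i) (t j) := by
    have h1 : ∫ x, x ^ 2 ∂(gaussianReal 0 v) = v := by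
      rw [← variance_fun_id_gaussianReal (μ := 0) (v := v),
        variance_eq_integral measurable_id'.aemeasurable]
      simp
    rw [← h1, ← hv, integral_map hYm.aemeasurable (by fun_prop)]
    have h2 : ∀ ω, Y ω ^ 2 = ∑ i, ∑ j, c i * c j * (X (t i) ω * X (t j) ω) := by
      intro ω
      rw [sq, hY, Finset.sum_mul_sum]
      exact Finset.sum_congr rfl fun i _ => Finset.sum_congr rfl fun j _ => by ring
    have hint : ∀ i j, Integrable (fun ω => c i * c j * (X (t i) ω * X (t j) ω)) P :=
      fun i j => ((hmem (t i)).integrable_mul (hmem (t j))).const_mul _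
    simp_rw [h2]
    rw [integral_finsetSum _ fun i _ => integrable_finsetSum _ fun j _ => hint i j]
    refine Finset.sum_congr rfl fun i _ => ?_
    rw [integral_finsetSum _ fun j _ => hint i j]
    exact Finset.sum_congr rfl fun j _ => by rw [integral_const_mul, hK]
  have h := charFun_gaussianReal (μ := 0) (v := v) 1
  rw [← hv, charFun_apply_real, integral_map hYm.aemeasurable (by fun_prop), hvar] at h
  convert h using 2 <;> simp [hY, neg_div]

lemma map_rat_eq_of_charFun_eq {Ω Ω' : Type*} [MeasurableSpace Ω] [MeasurableSpace Ω']
    {P : Measure Ω} {Q : Measure Ω'} [IsProbabilityMeasure P] [IsProbabilityMeasure Q]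
    {X : ℝ → Ω → ℝ} {Y : ℝ → Ω' → ℝ} (hX : ∀ t, Measurable (X t)) (hY : ∀ t, Measurable (Y t))
    (h : ∀ (I : Finset ℚ) (c : I → ℝ),
      ∫ ω, Complex.exp ((∑ i, c i * X (i : ℚ) ω : ℝ) * Complex.I) ∂P =
        ∫ ω, Complex.exp ((∑ i, c i * Y (i : ℚ) ω : ℝ) * Complex.I) ∂Q) :
    P.map (fun ω (q : ℚ) => X q ω) = Q.map (fun ω (q : ℚ) => Y q ω) := by
  have key : ∀ I : Finset ℚ, P.map (fun ω => I.restrict fun q : ℚ => X q ω) =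
      Q.map fun ω => I.restrict fun q : ℚ => Y q ω := by
    intro I
    have hXm : Measurable fun ω => I.restrict fun q : ℚ => X q ω :=
      measurable_pi_lambda _ fun i => hX _
    have hYm : Measurable fun ω => I.restrict fun q : ℚ => Y q ω :=
      measurable_pi_lambda _ fun i => hY _
    have := Measure.isProbabilityMeasure_map (μ := P) hXm.aemeasurable
    have := Measure.isProbabilityMeasure_map (μ := Q) hYm.aemeasurable
    refine Measure.ext_of_charFunDual ?_
    ext L
    obtain ⟨a, hL⟩ : ∃ a : I → ℝ, ∀ v, L v = ∑ i, a i * v i := by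
      refine ⟨fun i => L (Pi.single i 1), fun v => ?_⟩
      conv_lhs => rw [pi_eq_sum_univ' v, map_sum]
      refine Finset.sum_congr rfl fun i _ => ?_
      rw [map_smul, smul_eq_mul, mul_comm]
    rw [charFunDual_apply, charFunDual_apply, integral_map hXm.aemeasurable (by fun_prop),
      integral_map hYm.aemeasurable (by fun_prop)]
    simp_rw [hL]
    exact h I a
  have hlim := isProjectiveLimit_map (X := fun (q : ℚ) ω => X q ω) (P := P) (by fun_prop)
  simp_rw [key] at hlim
  exact hlim.unique (isProjectiveLimit_map (X := fun (q : ℚ) ω => Y q ω) (by fun_prop))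

/-- The length of the excursion of a continuous path above the level `u` that straddles time `0`,
computed from the values of the path at rational times. -/
noncomputable def rationalExcursionLength (u : ℝ) (x : ℚ → ℝ) : ℝ :=
  (rationalHittingTime u x).toReal + (rationalHittingTime u fun q => x (-q)).toReal

lemma measurable_rationalExcursionLength (u : ℝ) : Measurable (rationalExcursionLength u) :=
  (measurable_rationalHittingTime u).ennreal_toReal.add
    ((measurable_rationalHittingTime u).comp
      (measurable_pi_lambda _ fun q => measurable_pi_apply (-q))).ennreal_toReal

lemma sInf_sub_sSup_eq_rationalExcursionLength {x : ℝ → ℝ} (hx : Continuous x) (u : ℝ) :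
    sInf {t : ℝ | 0 ≤ t ∧ x t ≤ u} - sSup {t : ℝ | t ≤ 0 ∧ x t ≤ u} =
      rationalExcursionLength u fun q => x q := by
  have h := sInf_eq_toReal_rationalHittingTime (x := fun t => x (-t)) (by fun_prop) u
  rw [sSup_nonpos_eq_neg_sInf, sub_neg_eq_add, sInf_eq_toReal_rationalHittingTime hx, h,
    rationalExcursionLength]
  push_cast
  rfl

lemma integral_cond_excursion {Ω : Type*} [MeasurableSpace Ω] {P : Measure Ω}
    {X : ℝ → Ω → ℝ} (hX : ∀ t, Measurable (X t)) (hc : ∀ ω, Continuous fun t => X t ω)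
    (f : BoundedContinuousFunction ℝ ℝ) (u : ℝ) :
    ∫ ω, f (u * (sInf {t : ℝ | 0 ≤ t ∧ X t ω ≤ u}
        - sSup {t : ℝ | t ≤ 0 ∧ X t ω ≤ u})) ∂(P[|{ω | u < X 0 ω}]) =
      ∫ x, f (u * rationalExcursionLength u x)
        ∂((P.map fun ω (q : ℚ) => X q ω)[|{x | u < x 0}]) := by
  have hm : Measurable fun ω (q : ℚ) => X q ω := by fun_prop
  have hB : MeasurableSet {x : ℚ → ℝ | u < x 0} :=
    measurableSet_lt measurable_const (measurable_pi_apply 0)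
  have hpre : (fun ω (q : ℚ) => X q ω) ⁻¹' {x | u < x 0} = {ω | u < X 0 ω} := by
    ext ω; simp
  have hg : Measurable fun x => f (u * rationalExcursionLength u x) :=
    f.continuous.measurable.comp ((measurable_rationalExcursionLength u).const_mul u)
  rw [ProbabilityTheory.cond, ProbabilityTheory.cond, integral_smul_measure, integral_smul_measure, Measure.map_apply hm hB, hpre,
    setIntegral_map hB hg.aestronglyMeasurable hm.aemeasurable, hpre]
  simp_rw [fun ω => sInf_sub_sSup_eq_rationalExcursionLength (hc ω) u]

lemma setIntegral_Ioi_gaussianReal {u : ℝ} (hu : 0 < u) (G : ℝ → ℝ) :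
    ∫ x in Set.Ioi u, G x ∂(gaussianReal 0 1) =
      ((Real.sqrt (2 * Real.pi))⁻¹ * Real.exp (-u ^ 2 / 2) * u⁻¹) *
        ∫ e in Set.Ioi 0, Real.exp (-e - e ^ 2 / (2 * u ^ 2)) * G (u + e / u) := by
  set g : ℝ → ℝ := fun x => (Real.sqrt (2 * Real.pi))⁻¹ * Real.exp (-x ^ 2 / 2) * G x with hg
  have h1 : ∫ x in Set.Ioi u, G x ∂(gaussianReal 0 1) = ∫ x in Set.Ioi u, g x := by
    rw [← integral_indicator measurableSet_Ioi,
      integral_gaussianReal_eq_integral_smul one_ne_zero, ← integral_indicator measurableSet_Ioi]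
    refine integral_congr_ae (ae_of_all _ fun x => ?_)
    by_cases hx : x ∈ Set.Ioi u <;> simp [hx, hg, gaussianPDFReal_def]
  have h2 : ∫ x in Set.Ioi u, g x = ∫ y in Set.Ioi 0, g (u + y) := by
    have := (measurePreserving_add_left volume u).setIntegral_preimage_emb
      (measurableEmbedding_addLeft u) g (Set.Ioi u)
    rw [← this, Set.preimage_const_add_Ioi, sub_self]
  have h3 := integral_comp_mul_left_Ioi (fun y => g (u + y)) 0 (inv_pos.2 hu)
  rw [inv_inv, mul_zero, smul_eq_mul] at h3
  have h4 : ∫ y in Set.Ioi 0, g (u + y) = u⁻¹ * ∫ e in Set.Ioi 0, g (u + u⁻¹ * e) := by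
    rw [h3, inv_mul_cancel_left₀ hu.ne']
  rw [h1, h2, h4, mul_comm _ u⁻¹, mul_assoc]
  congr 1
  rw [← integral_const_mul]
  refine integral_congr_ae (ae_of_all _ fun e => ?_)
  have : -(u + u⁻¹ * e) ^ 2 / 2 = -u ^ 2 / 2 + (-e - e ^ 2 / (2 * u ^ 2)) := by
    field_simp
    ring
  simp only [hg]
  rw [this, Real.exp_add, div_eq_inv_mul e u]
  ring

lemma tendsto_setIntegral_exp_mul {G : ℝ → ℝ → ℝ} {g : ℝ → ℝ} {C : ℝ}
    (hm : ∀ u, Measurable (G u)) (hC : ∀ u x, |G u x| ≤ C)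
    (hG : ∀ e, 0 < e → Tendsto (fun u => G u (u + e / u)) atTop (nhds (g e))) :
    Tendsto (fun u : ℝ => ∫ e in Set.Ioi 0,
        Real.exp (-e - e ^ 2 / (2 * u ^ 2)) * G u (u + e / u)) atTop
      (nhds (∫ e in Set.Ioi 0, Real.exp (-e) * g e)) := by
  refine tendsto_integral_filter_of_dominated_convergence (fun e => C * Real.exp (-e))
    (.of_forall fun u => ?_) (.of_forall fun u => ae_of_all _ fun e => ?_)
    ((integrableOn_exp_neg_Ioi 0).const_mul C) ?_
  · have := hm u
    exact Measurable.aestronglyMeasurable (by fun_prop)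
  · rw [Real.norm_eq_abs, abs_mul, Real.abs_exp, mul_comm C]
    refine mul_le_mul (Real.exp_le_exp.2 ?_) (hC _ _) (abs_nonneg _) (Real.exp_pos _).le
    have : 0 ≤ e ^ 2 / (2 * u ^ 2) := by positivity
    linarith
  · refine (ae_restrict_iff' measurableSet_Ioi).2 (ae_of_all _ fun e he => ?_)
    refine Tendsto.mul ?_ (hG e he)
    refine (Real.continuous_exp.tendsto _).comp ?_
    have h : Tendsto (fun u : ℝ => e ^ 2 / (2 * u ^ 2)) atTop (nhds 0) :=
      ((tendsto_pow_atTop two_ne_zero).const_mul_atTop two_pos).const_div_atTop _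
    simpa using h.const_sub (-e)

lemma tendsto_integral_cond_gaussian_prod {E : Type*} [MeasurableSpace E] {ν : Measure E}
    [IsProbabilityMeasure ν] {F : ℝ → ℝ × E → ℝ} {L : ℝ → E → ℝ} {C : ℝ}
    (hm : ∀ u, Measurable (F u)) (hC : ∀ u z, |F u z| ≤ C)
    (hF : ∀ e, 0 < e → ∀ᵐ ω ∂ν, Tendsto (fun u => F u (u + e / u, ω)) atTop (nhds (L e ω))) :
    Tendsto (fun u => ∫ z, F u z ∂(((gaussianReal 0 1).prod ν)[|{z | u < z.1}])) atTop
      (nhds (∫ e in Set.Ioi 0, Real.exp (-e) * ∫ ω, L e ω ∂ν)) := by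
  set J : (ℝ → ℝ → ℝ) → ℝ → ℝ := fun G u =>
    ∫ e in Set.Ioi 0, Real.exp (-e - e ^ 2 / (2 * u ^ 2)) * G u (u + e / u) with hJ
  have hone : Tendsto (J fun _ _ => 1) atTop (nhds 1) := by
    have := tendsto_setIntegral_exp_mul (G := fun _ _ => 1) (g := fun _ => 1) (C := 1)
      (fun _ => measurable_const) (fun _ _ => by simp) (fun _ _ => tendsto_const_nhds)
    simpa only [hJ, mul_one, integral_exp_neg_Ioi_zero] using this
  have hnum : Tendsto (J fun u x => ∫ ω, F u (x, ω) ∂ν) atTop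
      (nhds (∫ e in Set.Ioi 0, Real.exp (-e) * ∫ ω, L e ω ∂ν)) := by
    refine tendsto_setIntegral_exp_mul (C := C)
      (fun u => ((hm u).stronglyMeasurable.integral_prod_right').measurable) (fun u x => ?_)
      fun e he => ?_
    · simpa using norm_integral_le_of_norm_le_const (μ := ν) (f := fun ω => F u (x, ω))
        (ae_of_all _ fun ω => hC u (x, ω))
    · refine tendsto_integral_filter_of_dominated_convergence (fun _ => C)
        (.of_forall fun u => ((hm u).comp measurable_prodMk_left).aestronglyMeasurable)
        (.of_forall fun u => ae_of_all _ fun ω => hC u _) (integrable_const _) (hF e he)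
  have hdiv := hnum.div hone one_ne_zero
  rw [div_one] at hdiv
  refine hdiv.congr' ?_
  filter_upwards [eventually_gt_atTop 0] with u hu
  have hset : {z : ℝ × E | u < z.1} = Set.Ioi u ×ˢ Set.univ := by ext z; simp
  have hP : ((gaussianReal 0 1).prod ν).real (Set.Ioi u ×ˢ Set.univ) =
      ∫ x in Set.Ioi u, (1 : ℝ) ∂(gaussianReal 0 1) := by
    simp [measureReal_prod_prod]
  have hint : Integrable (F u) ((gaussianReal 0 1).prod ν) :=
    Integrable.of_bound (hm u).aestronglyMeasurable C (ae_of_all _ (hC u))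
  rw [hset, ProbabilityTheory.cond, integral_smul_measure, ENNReal.toReal_inv, ← measureReal_def,
    hP, setIntegral_prod _ hint.integrableOn, setIntegral_Ioi_gaussianReal hu,
    setIntegral_Ioi_gaussianReal hu, smul_eq_mul, inv_mul_eq_div]
  simp only [Measure.restrict_univ, Pi.div_apply]
  rw [mul_div_mul_left]
  positivity

lemma integral_expMeasure_one (g : ℝ → ℝ) :
    ∫ e, g e ∂(expMeasure 1) = ∫ e in Set.Ioi 0, Real.exp (-e) * g e := by
  have hm : Measurable (gammaPDF 1 1) := (measurable_gammaPDFReal 1 1).ennreal_ofReal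
  rw [expMeasure, gammaMeasure, integral_withDensity_eq_integral_toReal_smul hm
    (ae_of_all _ fun _ => ENNReal.ofReal_lt_top),
    ← integral_Ici_eq_integral_Ioi, ← integral_indicator measurableSet_Ici]
  refine integral_congr_ae (ae_of_all _ fun e => ?_)
  change (exponentialPDF 1 e).toReal • g e = _
  rw [exponentialPDF_eq]
  by_cases he : 0 ≤ e <;> simp [he, (Real.exp_pos _).le]

lemma integral_prod_expMeasure_eq (f : BoundedContinuousFunction ℝ ℝ) :
    ∫ p : ℝ × ℝ, f (Real.sqrt (2 * (p.1 ^ 2 + 2 * p.2)))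
        ∂((gaussianReal 0 1).prod (expMeasure 1)) =
      ∫ e in Set.Ioi 0, Real.exp (-e) *
        ∫ ω, f (Real.sqrt ((Real.sqrt 2 * ω 0) ^ 2 + 4 * e)) ∂gaussianSeq := by
  have := isProbabilityMeasure_expMeasure one_pos
  have hc : Continuous fun p : ℝ × ℝ => f (Real.sqrt (2 * (p.1 ^ 2 + 2 * p.2))) := by fun_prop
  rw [integral_prod_symm _ (Integrable.of_bound hc.aestronglyMeasurable ‖f‖
    (ae_of_all _ fun p => f.norm_coe_le_norm _)), integral_expMeasure_one]
  congr 1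
  ext e
  congr 1
  have h0 := (measurePreserving_eval_infinitePi (fun _ : ℕ => gaussianReal 0 1) 0).map_eq
  rw [← h0, integral_map (measurable_pi_apply 0).aemeasurable (by fun_prop)]
  refine integral_congr_ae (ae_of_all _ fun ω => ?_)
  simp only [mul_pow, Real.sq_sqrt zero_le_two]
  congr 2
  ring

/-- for the stationary Gaussian process with covariance `e^{-|s-t|²}`,
conditionally on `[X₀ > u]`, `u (τ_u⁺ - τ_u⁻)` converges in distribution, as `u → ∞`, to
`√(2(Z² + 2T*))` with `Z` standard normal, `T*` standard exponential, independent
(realized on the product measure `(gaussianReal 0 1).prod (expMeasure 1)`). -/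
theorem excursion_stmt18
    {Ω : Type*} [MeasurableSpace Ω] (P : Measure Ω) [IsProbabilityMeasure P]
    (X : ℝ → Ω → ℝ)
    (hX_gauss : IsZeroMeanGaussianProcess P X)
    (hX_cont : ∀ ω, Continuous fun t => X t ω)
    (hX_cov : ∀ s t : ℝ, ∫ ω, X s ω * X t ω ∂P = Real.exp (-|s - t| ^ 2)) :
    ∀ f : BoundedContinuousFunction ℝ ℝ,
      Tendsto (fun u : ℝ =>
          ∫ ω, f (u * (sInf {t : ℝ | 0 ≤ t ∧ X t ω ≤ u}
              - sSup {t : ℝ | t ≤ 0 ∧ X t ω ≤ u})) ∂(P[|{ω | u < X 0 ω}]))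
        atTop
        (nhds (∫ p : ℝ × ℝ, f (Real.sqrt (2 * (p.1 ^ 2 + 2 * p.2)))
          ∂((gaussianReal 0 1).prod (expMeasure 1)))) := by
  intro f
  have hlaw : P.map (fun ω (q : ℚ) => X q ω) =
      ((gaussianReal 0 1).prod gaussianSeq).map fun z (q : ℚ) => analyticProcess q z :=
    map_rat_eq_of_charFun_eq hX_gauss.1 measurable_analyticProcess fun I c => by
      rw [hX_gauss.charFun hX_cov, charFun_analyticProcess]
  have hF : ∀ u z, f (u * (sInf {t : ℝ | 0 ≤ t ∧ analyticProcess t z ≤ u}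
      - sSup {t : ℝ | t ≤ 0 ∧ analyticProcess t z ≤ u})) =
      f (u * rationalExcursionLength u fun q => analyticProcess q z) := fun u z => by
    rw [sInf_sub_sSup_eq_rationalExcursionLength (continuous_analyticProcess z)]
  have hset : ∀ u : ℝ, {z : ℝ × (ℕ → ℝ) | u < analyticProcess 0 z} = {z | u < z.1} := by
    simp [analyticProcess]
  rw [integral_prod_expMeasure_eq]
  refine Tendsto.congr (fun u => ?_) (tendsto_integral_cond_gaussian_prod
    (F := fun u z => f (u * (sInf {t : ℝ | 0 ≤ t ∧ analyticProcess t z ≤ u}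
      - sSup {t : ℝ | t ≤ 0 ∧ analyticProcess t z ≤ u})))
    (L := fun e ω => f (Real.sqrt ((Real.sqrt 2 * ω 0) ^ 2 + 4 * e))) (C := ‖f‖)
    (fun u => ?_) (fun u z => f.norm_coe_le_norm _) fun e he => ?_)
  · rw [← hset, integral_cond_excursion hX_gauss.1 hX_cont, hlaw,
      integral_cond_excursion measurable_analyticProcess continuous_analyticProcess]
  · have h : Measurable fun z => rationalExcursionLength u fun q => analyticProcess q z :=
      (measurable_rationalExcursionLength u).comp
        (measurable_pi_lambda _ fun q => measurable_analyticProcess q)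
    convert f.continuous.measurable.comp (h.const_mul u) using 1
    exact funext (hF u)
  · filter_upwards [ae_mem_expGrowth] with ω hω
    have h := tendsto_mul_excursion_length (continuous_slopeSeries ω).continuousAt he
    rw [slopeSeries_zero, tameSeq_of_mem hω] at h
    exact (f.continuous.tendsto _).comp h
end
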